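/- arXiv:1110.4660 — 11 statements merged into one kernel-verified Lean document; each statement's English description precedes it below -/
import Mathlib

section
/- Let d ≥ 1 be an integer, let E be a finite set with |E| = d², and let c : E → ℤ^d. Then the following are equivalent: (a) there exists a map h : E → ℝ^d with h(e) ≠ 0 for every e ∈ E such that the family of d×d real matrices (c(e)·h(e)ᵀ)_{e ∈ E} is linearly independent over ℝ (hence a basis of the d²-dimensional space of d×d matrices); (b) for every subset F ⊆ E one has |F| ≤ d · dim_ℝ span{c(e) : e ∈ F}. (Theorem: characterization of minimally rigid d-periodic body-and-bar graphs with a single body orbit.) -/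
/-- Submodular uncrossing step in Rado's theorem for subspaces. -/
theorem rado_step {K V E : Type*} [Field K] [AddCommGroup V] [Module K V]
    [FiniteDimensional K V] [DecidableEq E] (A : E → Submodule K V)
    (hA : ∀ F : Finset E, F.card ≤ Module.finrank K (F.sup A : Submodule K V))
    (e : E) (H₁ H₂ : Submodule K V) (hH : A e = H₁ ⊔ H₂) :
    (∀ F : Finset E, F.card ≤ Module.finrank K (F.sup (Function.update A e H₁) : Submodule K V)) ∨
    (∀ F : Finset E, F.card ≤ Module.finrank K
      (F.sup (Function.update A e H₂) : Submodule K V)) := by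
  have key : ∀ H : Submodule K V,
      (¬ ∀ F : Finset E, F.card ≤ Module.finrank K
        (F.sup (Function.update A e H) : Submodule K V)) →
      ∃ F : Finset E, e ∉ F ∧ Module.finrank K (H ⊔ F.sup A : Submodule K V) ≤ F.card := by
    intro H hn
    push Not at hn
    obtain ⟨F, hF⟩ := hn
    have hsup : ∀ G : Finset E, e ∉ G → G.sup (Function.update A e H) = G.sup A := by
      intro G hG
      apply Finset.sup_congr rfl
      intro x hx
      rw [Function.update_of_ne]
      rintro rfl
      exact hG hx
    by_cases he : e ∈ F
    · refine ⟨F.erase e, Finset.notMem_erase e F, ?_⟩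
      rw [← Finset.insert_erase he, Finset.sup_insert, Function.update_self,
        hsup _ (Finset.notMem_erase e F),
        Finset.card_insert_of_notMem (Finset.notMem_erase e F)] at hF
      omega
    · rw [hsup F he] at hF
      exact absurd (hA F) (by omega)
  by_contra hcon
  rw [not_or] at hcon
  obtain ⟨F₁, h1, hF₁⟩ := key H₁ hcon.1
  obtain ⟨F₂, h2, hF₂⟩ := key H₂ hcon.2
  have hmod := Submodule.finrank_sup_add_finrank_inf_eq (H₁ ⊔ F₁.sup A) (H₂ ⊔ F₂.sup A)
  have hu : (insert e (F₁ ∪ F₂)).sup A ≤ (H₁ ⊔ F₁.sup A) ⊔ (H₂ ⊔ F₂.sup A) := by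
    rw [Finset.sup_insert, Finset.sup_union, hH]
    exact le_of_eq (sup_sup_sup_comm _ _ _ _)
  have hi : (F₁ ∩ F₂).sup A ≤ (H₁ ⊔ F₁.sup A) ⊓ (H₂ ⊔ F₂.sup A) :=
    le_inf ((Finset.sup_mono Finset.inter_subset_left).trans le_sup_right)
      ((Finset.sup_mono Finset.inter_subset_right).trans le_sup_right)
  have hu' := (hA _).trans (Submodule.finrank_mono hu)
  have hi' := (hA _).trans (Submodule.finrank_mono hi)
  rw [Finset.card_insert_of_notMem (by simp [h1, h2])] at hu'
  have := Finset.card_union_add_card_inter F₁ F₂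
  omega

/-- A subspace of dimension at least two is a sum of two strictly smaller subspaces. -/
theorem exists_split {K V : Type*} [Field K] [AddCommGroup V] [Module K V]
    [FiniteDimensional K V] (A : Submodule K V) (h : 2 ≤ Module.finrank K A) :
    ∃ H₁ H₂ : Submodule K V, A = H₁ ⊔ H₂ ∧ Module.finrank K H₁ < Module.finrank K A ∧
      Module.finrank K H₂ < Module.finrank K A := by
  have hne : A ≠ ⊥ := by
    rintro rfl
    simp at h
  obtain ⟨v, hv, hv0⟩ := Submodule.exists_mem_ne_zero_of_ne_bot hne
  have hle : K ∙ v ≤ A := (Submodule.span_singleton_le_iff_mem v A).2 hv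
  obtain ⟨q, hq⟩ := exists_isCompl (K ∙ v)
  have h1 := finrank_span_singleton (K := K) hv0
  have heq : A = (K ∙ v) ⊔ (q ⊓ A) := by
    rw [← sup_inf_assoc_of_le q hle, hq.sup_eq_top, top_inf_eq]
  refine ⟨K ∙ v, q ⊓ A, heq, by omega, ?_⟩
  apply Submodule.finrank_lt_finrank_of_lt
  refine lt_of_le_of_ne inf_le_right fun hh => hv0 ?_
  have hvq : v ∈ q := (hh.symm.le hv).1
  exact (Submodule.disjoint_def.1 hq.disjoint) v (Submodule.mem_span_singleton_self v) hvq

/-- Rado's theorem for families of subspaces. -/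
theorem rado_subspaces {K V E : Type*} [Field K] [AddCommGroup V] [Module K V]
    [FiniteDimensional K V] [Fintype E] [DecidableEq E] (n : ℕ) :
    ∀ (A : E → Submodule K V), (∑ e, Module.finrank K (A e) = n) →
    (∀ F : Finset E, F.card ≤ Module.finrank K (F.sup A : Submodule K V)) →
    ∃ v : E → V, (∀ e, v e ∈ A e) ∧ LinearIndependent K v := by
  induction n using Nat.strong_induction_on with
  | _ n ih =>
  intro A hn hA
  by_cases hbig : ∃ e, 2 ≤ Module.finrank K (A e)
  · obtain ⟨e, he⟩ := hbig
    obtain ⟨H₁, H₂, hH, hl1, hl2⟩ := exists_split (A e) he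
    have fin : ∀ H : Submodule K V, H ≤ A e → Module.finrank K H < Module.finrank K (A e) →
        (∀ F : Finset E, F.card ≤ Module.finrank K
          (F.sup (Function.update A e H) : Submodule K V)) →
        ∃ v : E → V, (∀ e, v e ∈ A e) ∧ LinearIndependent K v := by
      intro H hle hlt hH
      have hupd : ∀ x, Function.update A e H x ≤ A x := by
        intro x
        by_cases hx : x = e
        · subst hx
          simpa using hle
        · rw [Function.update_of_ne hx]
      obtain ⟨v, hv, hli⟩ := ih (∑ x, Module.finrank K (Function.update A e H x)) (by
        rw [← hn]
        apply Finset.sum_lt_sum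
        · intro x _
          exact Submodule.finrank_mono (hupd x)
        · exact ⟨e, Finset.mem_univ e, by rw [Function.update_self]; exact hlt⟩)
        (Function.update A e H) rfl hH
      exact ⟨v, fun x => hupd x (hv x), hli⟩
    rcases rado_step A hA e H₁ H₂ hH with h | h
    · exact fin H₁ (hH ▸ le_sup_left) hl1 h
    · exact fin H₂ (hH ▸ le_sup_right) hl2 h
  · push Not at hbig
    have hex : ∀ e, ∃ v : V, v ∈ A e ∧ A e = K ∙ v := by
      intro e
      have h1 : Module.finrank K (A e) ≤ 1 := by
        have := hbig e
        omega
      rw [Submodule.finrank_le_one_iff_isPrincipal] at h1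
      obtain ⟨v, hv⟩ := h1.principal
      exact ⟨v, hv ▸ Submodule.mem_span_singleton_self v, hv⟩
    choose v hv hAv using hex
    refine ⟨v, hv, ?_⟩
    rw [linearIndependent_iff_card_le_finrank_span]
    refine (hA Finset.univ).trans (Submodule.finrank_mono ?_)
    apply Finset.sup_le
    intro e _
    rw [hAv e, Submodule.span_singleton_le_iff_mem]
    exact Submodule.subset_span ⟨e, rfl⟩

/-- Matrices all of whose columns lie in `W`, as image of tuples of vectors in `W`. -/
noncomputable def colMap {d : ℕ} (W : Submodule ℝ (Fin d → ℝ)) :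
    (Fin d → W) →ₗ[ℝ] Matrix (Fin d) (Fin d) ℝ where
  toFun f := Matrix.of fun r j => (f j : Fin d → ℝ) r
  map_add' f g := by ext; simp
  map_smul' a f := by ext; simp

theorem finrank_colMap {d : ℕ} (W : Submodule ℝ (Fin d → ℝ)) :
    Module.finrank ℝ (LinearMap.range (colMap W)) = d * Module.finrank ℝ W := by
  rw [LinearMap.finrank_range_of_inj]
  · rw [Module.finrank_pi_fintype]
    simp
  · intro f g hfg
    ext j r
    exact congrFun (congrFun hfg r) j

/-- The bilinear outer product. -/
noncomputable def outerB (d : ℕ) :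
    (Fin d → ℝ) →ₗ[ℝ] (Fin d → ℝ) →ₗ[ℝ] Matrix (Fin d) (Fin d) ℝ :=
  LinearMap.mk₂ ℝ Matrix.vecMulVec Matrix.add_vecMulVec Matrix.smul_vecMulVec
    Matrix.vecMulVec_add (fun c m n => Matrix.vecMulVec_smul c m n)

/-- The map `h ↦ u hᵀ`. -/
noncomputable def outerL {d : ℕ} (u : Fin d → ℝ) :
    (Fin d → ℝ) →ₗ[ℝ] Matrix (Fin d) (Fin d) ℝ :=
  outerB d u

theorem outerL_apply {d : ℕ} (u h : Fin d → ℝ) : outerL u h = Matrix.vecMulVec u h := rfl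

theorem vecMulVec_mem_colMap {d : ℕ} (W : Submodule ℝ (Fin d → ℝ)) (u h : Fin d → ℝ)
    (hu : u ∈ W) : Matrix.vecMulVec u h ∈ LinearMap.range (colMap W) := by
  refine ⟨fun j => h j • ⟨u, hu⟩, ?_⟩
  ext r j
  simp [colMap, Matrix.vecMulVec_apply, mul_comm]

theorem colMap_le_sup {d : ℕ} {E : Type*} (u : E → Fin d → ℝ) (F : Finset E) :
    LinearMap.range (colMap (Submodule.span ℝ (u '' (F : Set E)))) ≤
      F.sup fun e => LinearMap.range (outerL (u e)) := by
  rintro _ ⟨f, rfl⟩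
  have hw : ∀ h : Fin d → ℝ, Submodule.span ℝ (u '' (F : Set E)) ≤
      (F.sup fun e => LinearMap.range (outerL (u e))).comap
        ((outerB d).flip h : (Fin d → ℝ) →ₗ[ℝ] Matrix (Fin d) (Fin d) ℝ) := by
    intro h
    rw [Submodule.span_le]
    rintro _ ⟨e, he, rfl⟩
    have hle : LinearMap.range (outerL (u e)) ≤ F.sup fun e => LinearMap.range (outerL (u e)) :=
      Finset.le_sup (f := fun e => LinearMap.range (outerL (u e))) he
    exact hle ⟨h, rfl⟩
  have hsum : colMap _ f = ∑ j, Matrix.vecMulVec (f j : Fin d → ℝ) (Pi.single j 1) := by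
    ext r j
    simp [colMap, Matrix.sum_apply, Matrix.vecMulVec_apply, Pi.single_apply]
  rw [hsum]
  exact Submodule.sum_mem _ fun j _ => hw (Pi.single j 1) (f j).2

/-- one body orbit case, Theorem 1 of the paper.
For `d ≥ 1`, a finite set `E` of `d²` edge classes with lifting vectors `c : E → ℤ^d`,
there is a choice of nonzero edge vectors `h : E → ℝ^d` making the rank-one matrices
`c(e)·h(e)ᵀ` a linearly independent family (i.e. an infinitesimally rigid presentation)
iff `|F| ≤ d · dim span {c(e) : e ∈ F}` for every `F ⊆ E`. -/
theorem stmt_0 {d : ℕ} (hd : 1 ≤ d) {E : Type*} [Fintype E]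
    (hE : Fintype.card E = d ^ 2) (c : E → Fin d → ℤ) :
    (∃ h : E → Fin d → ℝ, (∀ e, h e ≠ 0) ∧
        LinearIndependent ℝ
          (fun e : E => Matrix.vecMulVec (fun r => (c e r : ℝ)) (h e)))
      ↔ ∀ F : Finset E,
          F.card ≤ d * Module.finrank ℝ (Submodule.span ℝ
            ((fun e => fun r => (c e r : ℝ)) '' (F : Set E))) := by
  classical
  constructor
  · rintro ⟨h, -, hli⟩ F
    rw [← finrank_colMap]
    have hli' := hli.comp (fun e : F => (e : E)) Subtype.val_injective
    have hle : Submodule.span ℝ (Set.range ((fun e : E =>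
        Matrix.vecMulVec (fun r => (c e r : ℝ)) (h e)) ∘ (fun e : F => (e : E)))) ≤
        LinearMap.range (colMap (Submodule.span ℝ
            ((fun e => fun r => (c e r : ℝ)) '' (F : Set E)))) := by
      rw [Submodule.span_le]
      rintro _ ⟨e, rfl⟩
      exact vecMulVec_mem_colMap _ _ _ (Submodule.subset_span ⟨e, e.2, rfl⟩)
    have := Submodule.finrank_mono hle
    rw [finrank_span_eq_card hli', Fintype.card_coe] at this
    exact this
  · intro hF
    obtain ⟨v, hv, hli⟩ := rado_subspaces _
      (fun e => LinearMap.range (outerL (fun r => (c e r : ℝ)))) rfl (fun F => by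
        refine (hF F).trans ?_
        rw [← finrank_colMap]
        exact Submodule.finrank_mono (colMap_le_sup (fun e => fun r => (c e r : ℝ)) F))
    choose h hh using hv
    refine ⟨h, fun e he => hli.ne_zero e ?_, ?_⟩
    · rw [← hh e, he, map_zero]
    · have : v = fun e : E => Matrix.vecMulVec (fun r => (c e r : ℝ)) (h e) :=
        funext fun e => (hh e).symm
      exact this ▸ hli
end

section
/- Let d ≥ 1 and let k_1, …, k_ℓ be positive integers with k_1 + ⋯ + k_ℓ = d². Then the following are equivalent: (a) there exist nonzero vectors c_1, …, c_ℓ ∈ ℤ^d, pairwise distinct up to sign (c_i ≠ c_j and c_i ≠ −c_j for i ≠ j), such that for every subset S ⊆ {1,…,ℓ} one has Σ_{i∈S} k_i ≤ d · dim_ℝ span{c_i : i ∈ S}; (b) k_i ≤ d for every i. (Corollary: a single-vertex quotient graph with loop multiplicities k_1,…,k_ℓ comes from a minimally rigid d-periodic body-and-bar graph if and only if all multiplicities are at most d.) -/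
theorem moment_linInd {d m : ℕ} (hm : m ≤ d) (v : Fin m → ℝ) (hv : Function.Injective v) :
    LinearIndependent ℝ (fun a : Fin m => fun r : Fin d => v a ^ (r : ℕ)) := by
  have h : LinearIndependent ℝ (Matrix.vandermonde v).row :=
    Matrix.linearIndependent_rows_of_det_ne_zero (Matrix.det_vandermonde_ne_zero_iff.mpr hv)
  refine LinearIndependent.of_comp (LinearMap.funLeft ℝ ℝ (Fin.castLE hm)) ?_
  convert h using 1
  ext a r
  simp [LinearMap.funLeft_apply, Matrix.vandermonde_apply, Matrix.row]

theorem moment_rank {d ℓ : ℕ} (S : Finset (Fin ℓ)) :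
    min S.card d ≤ Module.finrank ℝ (Submodule.span ℝ
      ((fun i : Fin ℓ => fun r : Fin d => ((((i : ℕ) : ℤ) ^ (r : ℕ) : ℤ) : ℝ)) ''
        (S : Set (Fin ℓ)))) := by
  obtain ⟨T, hTS, hT⟩ := Finset.exists_subset_card_eq (min_le_left S.card d)
  have hli := moment_linInd (d := d) (m := min S.card d) (min_le_right _ _)
    (fun a => (((T.orderEmbOfFin hT a : Fin ℓ) : ℕ) : ℝ)) (by
      intro a b hab
      have h1 := Nat.cast_injective (R := ℝ) hab
      exact (T.orderEmbOfFin hT).injective (Fin.ext h1))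
  have h2 := finrank_span_eq_card hli
  rw [Fintype.card_fin] at h2
  rw [← h2]
  apply Submodule.finrank_mono
  apply Submodule.span_mono
  rintro _ ⟨a, rfl⟩
  refine ⟨T.orderEmbOfFin hT a, hTS (T.orderEmbOfFin_mem hT a), ?_⟩
  funext r
  push_cast
  rfl

/-- single-vertex quotient graph with loop multiplicities.
For `d ≥ 1` and positive multiplicities `k₁,…,k_ℓ` summing to `d²`, there exist nonzero
integer lifting vectors `c₁,…,c_ℓ`, pairwise distinct up to sign, satisfying the weighted
sparsity condition `Σ_{i∈S} k_i ≤ d · dim span {c_i : i ∈ S}` for all `S`, iff every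
multiplicity is at most `d`. -/
theorem stmt_1 {d ℓ : ℕ} (hd : 1 ≤ d) (k : Fin ℓ → ℕ) (hk : ∀ i, 1 ≤ k i)
    (hsum : ∑ i, k i = d ^ 2) :
    (∃ c : Fin ℓ → Fin d → ℤ, (∀ i, c i ≠ 0) ∧
        (∀ i j, i ≠ j → c i ≠ c j ∧ c i ≠ -c j) ∧
        ∀ S : Finset (Fin ℓ),
          ∑ i ∈ S, k i ≤ d * Module.finrank ℝ (Submodule.span ℝ
            ((fun i => fun r => (c i r : ℝ)) '' (S : Set (Fin ℓ)))))
      ↔ ∀ i, k i ≤ d := by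
  constructor
  · rintro ⟨c, -, -, h⟩ i
    have h1 := h {i}
    rw [Finset.sum_singleton, Finset.coe_singleton, Set.image_singleton] at h1
    refine h1.trans ((Nat.mul_le_mul_left d ?_).trans (mul_one d).le)
    have h2 := finrank_span_le_card (R := ℝ) ({fun r => (c i r : ℝ)} : Set (Fin d → ℝ))
    simpa using h2
  · intro h
    refine ⟨fun i r => ((i : ℕ) : ℤ) ^ (r : ℕ), ?_, ?_, ?_⟩
    · intro i hi
      have := congrFun hi ⟨0, hd⟩
      simp at this
    · intro i j hij
      refine ⟨?_, ?_⟩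
      · intro he
        rcases Nat.lt_or_ge 1 d with h1 | h1
        · have := congrFun he ⟨1, h1⟩
          simp at this
          exact hij (Fin.ext this)
        · obtain rfl : d = 1 := by omega
          have h3 : ∑ i : Fin ℓ, 1 ≤ ∑ i, k i := Finset.sum_le_sum fun i _ => hk i
          rw [hsum] at h3
          simp at h3
          apply hij
          ext
          omega
      · intro he
        have := congrFun he ⟨0, hd⟩
        simp at this
    · intro S
      refine le_trans ?_ (Nat.mul_le_mul_left d (moment_rank S))
      rcases le_total S.card d with h1 | h1
      · rw [min_eq_left h1, mul_comm, ← smul_eq_mul]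
        exact Finset.sum_le_card_nsmul _ _ _ fun i _ => h i
      · rw [min_eq_right h1, ← sq, ← hsum]
        exact Finset.sum_le_sum_of_subset (Finset.subset_univ S)
end

section
/- Let t ≥ 1 be an integer, let E be a finite set, let W be a finite-dimensional real vector space, and let c : E → W. Then E can be partitioned into t subsets E_1, …, E_t such that for each i the family (c(e))_{e ∈ E_i} is linearly independent over ℝ, if and only if |F| ≤ t · dim_ℝ span{c(e) : e ∈ F} for every subset F ⊆ E. (Matroid-union statement underlying the sufficiency proof of the one-body-orbit theorem: the matroid associated to the increasing submodular function F ↦ t·dim span c(F) is the union of t copies of the linear matroid of c.) -/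
/-- Rado's theorem for finite sets of vectors. -/
theorem rado_aux {E V : Type*} [Fintype E] [AddCommGroup V] [Module ℝ V]
    [FiniteDimensional ℝ V] (n : ℕ) : ∀ (S : E → Finset V), ∑ e, (S e).card = n →
    (∀ F : Finset E, F.card ≤
      Module.finrank ℝ (F.sup fun e => Submodule.span ℝ (S e : Set V) : Submodule ℝ V)) →
    ∃ f : E → V, (∀ e, f e ∈ S e) ∧ LinearIndependent ℝ f := by
  classical
  induction n using Nat.strong_induction_on with
  | _ n ih =>
  intro S hS h
  have hne : ∀ e, (S e).Nonempty := by
    intro e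
    rw [Finset.nonempty_iff_ne_empty]
    intro h0
    have := h {e}
    simp [h0] at this
  by_cases hbig : ∃ e, 1 < (S e).card
  · obtain ⟨e, he⟩ := hbig
    obtain ⟨x, hx, y, hy, hxy⟩ := Finset.one_lt_card.1 he
    -- a failed deletion gives a tight set
    have key : ∀ z ∈ S e, (∃ f : E → V, (∀ e, f e ∈ S e) ∧ LinearIndependent ℝ f) ∨
        ∃ F : Finset E, e ∉ F ∧ Module.finrank ℝ
          ((F.sup fun e => Submodule.span ℝ (S e : Set V)) ⊔
            Submodule.span ℝ ((S e).erase z : Set V) : Submodule ℝ V) ≤ F.card := by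
      intro z hz
      by_cases hc : ∀ F : Finset E, F.card ≤ Module.finrank ℝ (F.sup fun e' =>
          Submodule.span ℝ (Function.update S e ((S e).erase z) e' : Set V) : Submodule ℝ V)
      · left
        have hlt : ∑ e', (Function.update S e ((S e).erase z) e').card < n := by
          rw [← hS]
          apply Finset.sum_lt_sum
          · intro i _
            by_cases hi : i = e
            · subst hi; simp [Finset.card_erase_le]
            · simp [hi]
          · exact ⟨e, Finset.mem_univ _, by simpa using Finset.card_erase_lt_of_mem hz⟩
        obtain ⟨f, hf, hli⟩ := ih _ hlt _ rfl hc
        refine ⟨f, fun i => ?_, hli⟩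
        have := hf i
        by_cases hi : i = e
        · subst hi
          rw [Function.update_self] at this
          exact Finset.mem_of_mem_erase this
        · rwa [Function.update_of_ne hi] at this
      · right
        push Not at hc
        obtain ⟨F, hF⟩ := hc
        have hcongr : ∀ G : Finset E, e ∉ G → (G.sup fun e' =>
            Submodule.span ℝ (Function.update S e ((S e).erase z) e' : Set V)) =
            (G.sup fun e => Submodule.span ℝ (S e : Set V)) := by
          intro G hG
          refine Finset.sup_congr rfl fun i hi => ?_
          have hie : i ≠ e := by
            rintro rfl
            exact hG hi
          rw [Function.update_of_ne hie]
        by_cases heF : e ∈ F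
        · refine ⟨F.erase e, Finset.notMem_erase _ _, ?_⟩
          rw [← Finset.insert_erase heF, Finset.sup_insert,
            hcongr _ (Finset.notMem_erase _ _), Function.update_self, sup_comm,
            Finset.card_insert_of_notMem (Finset.notMem_erase _ _)] at hF
          omega
        · rw [hcongr F heF] at hF
          exact absurd (h F) (by omega)
    rcases key x hx with h1 | ⟨F, heF, hF⟩
    · exact h1
    rcases key y hy with h1 | ⟨G, heG, hG⟩
    · exact h1
    exfalso
    set s : E → Submodule ℝ V := fun e => Submodule.span ℝ (S e : Set V) with hs
    set A := F.sup s ⊔ Submodule.span ℝ ((S e).erase x : Set V) with hA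
    set B := G.sup s ⊔ Submodule.span ℝ ((S e).erase y : Set V) with hB
    have hsub := Submodule.finrank_sup_add_finrank_inf_eq A B
    have h1 : (insert e (F ∪ G)).sup s ≤ A ⊔ B := by
      rw [Finset.sup_insert, Finset.sup_union]
      refine sup_le ?_ (sup_le_sup le_sup_left le_sup_left)
      refine Submodule.span_le.2 fun w hw => ?_
      by_cases hwx : w = x
      · refine (le_sup_right.trans le_sup_right : _ ≤ A ⊔ B) (Submodule.subset_span ?_)
        subst hwx
        exact Finset.mem_coe.2 (Finset.mem_erase.2 ⟨hxy, hw⟩)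
      · refine (le_sup_right.trans le_sup_left : _ ≤ A ⊔ B) (Submodule.subset_span ?_)
        exact Finset.mem_coe.2 (Finset.mem_erase.2 ⟨hwx, hw⟩)
    have h2 : (F ∩ G).sup s ≤ A ⊓ B :=
      le_inf ((Finset.sup_mono Finset.inter_subset_left).trans le_sup_left)
        ((Finset.sup_mono Finset.inter_subset_right).trans le_sup_left)
    have h3 := Submodule.finrank_mono h1
    have h4 := Submodule.finrank_mono h2
    have h5 := h (insert e (F ∪ G))
    have h6 := h (F ∩ G)
    rw [Finset.card_insert_of_notMem (by simp [heF, heG])] at h5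
    have h7 := Finset.card_union_add_card_inter F G
    omega
  · push Not at hbig
    choose f hf using hne
    refine ⟨f, hf, ?_⟩
    rw [linearIndependent_iff_card_le_finrank_span]
    refine (h Finset.univ).trans (Submodule.finrank_mono ?_)
    refine Finset.sup_le fun e _ => Submodule.span_mono fun w hw => ?_
    exact ⟨e, Finset.card_le_one.1 (hbig e) _ (hf e) _ hw⟩

/-- matroid union / Pym–Perfect for `t` copies of a linear matroid.
A finite family of vectors `c : E → W` can be partitioned into `t` linearly independent
subfamilies iff `|F| ≤ t · dim span c(F)` for every subset `F ⊆ E`. -/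
theorem stmt_2 {t : ℕ} (ht : 1 ≤ t) {E : Type*} [Fintype E]
    {W : Type*} [AddCommGroup W] [Module ℝ W] [FiniteDimensional ℝ W]
    (c : E → W) :
    (∃ P : E → Fin t, ∀ i : Fin t,
        LinearIndependent ℝ (fun e : {e : E // P e = i} => c e.1))
      ↔ ∀ F : Finset E,
          F.card ≤ t * Module.finrank ℝ (Submodule.span ℝ (c '' (F : Set E))) := by
  classical
  constructor
  · rintro ⟨P, hP⟩ F
    rw [Finset.card_eq_sum_card_fiberwise (f := P) (t := Finset.univ) (by simp)]
    refine (Finset.sum_le_card_nsmul _ _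
      (Module.finrank ℝ (Submodule.span ℝ (c '' (F : Set E)))) fun i _ => ?_).trans (by simp)
    have hli : LinearIndependent ℝ (fun e : {e // e ∈ F.filter (fun e => P e = i)} => c e.1) :=
      (hP i).comp (fun e : {e // e ∈ F.filter (fun e => P e = i)} =>
        (⟨e.1, (Finset.mem_filter.1 e.2).2⟩ : {e : E // P e = i}))
        (fun a b hab => Subtype.ext (congrArg (fun z => z.1) hab))
    have := linearIndependent_iff_card_le_finrank_span.1 hli
    rw [Fintype.card_coe] at this
    refine this.trans (Submodule.finrank_mono (Submodule.span_mono ?_))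
    rintro _ ⟨e, rfl⟩
    exact ⟨e.1, (Finset.mem_filter.1 e.2).1, rfl⟩
  · intro h
    let S : E → Finset (Fin t → W) := fun e =>
      Finset.univ.image fun i => LinearMap.single ℝ (fun _ : Fin t => W) i (c e)
    obtain ⟨f, hf, hli⟩ := rado_aux _ S rfl (by
      intro F
      refine (h F).trans ?_
      set p := Submodule.span ℝ (c '' (F : Set E)) with hp
      have hinj : Function.Injective (p.subtype.compLeft (Fin t)) := by
        intro a b hab
        funext i
        exact Subtype.ext (congrFun hab i)
      have hr := LinearMap.finrank_range_of_inj hinj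
      rw [Module.finrank_pi_fintype] at hr
      simp only [Finset.sum_const, Finset.card_univ, Fintype.card_fin, smul_eq_mul] at hr
      rw [← hr]
      refine Submodule.finrank_mono ?_
      rintro _ ⟨x, rfl⟩
      rw [← Finset.univ_sum_single (p.subtype.compLeft (Fin t) x)]
      refine Submodule.sum_mem _ fun i _ => ?_
      have hle : p ≤ Submodule.comap (LinearMap.single ℝ (fun _ : Fin t => W) i)
          (F.sup fun e => Submodule.span ℝ (S e : Set (Fin t → W))) := by
        refine Submodule.span_le.2 ?_
        rintro _ ⟨e, he, rfl⟩
        refine (Finset.le_sup (f := fun e => Submodule.span ℝ (S e : Set (Fin t → W))) he)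
          (Submodule.subset_span ?_)
        exact Finset.mem_coe.2 (Finset.mem_image.2 ⟨i, Finset.mem_univ _, rfl⟩)
      exact hle (x i).2)
    have hP : ∀ e, ∃ i, LinearMap.single ℝ (fun _ : Fin t => W) i (c e) = f e := by
      intro e
      obtain ⟨i, _, hi⟩ := Finset.mem_image.1 (hf e)
      exact ⟨i, hi⟩
    choose P hP using hP
    refine ⟨P, fun i => ?_⟩
    refine LinearIndependent.of_comp (LinearMap.single ℝ (fun _ : Fin t => W) i) ?_
    have heq : (LinearMap.single ℝ (fun _ : Fin t => W) i) ∘ (fun e : {e : E // P e = i} => c e.1)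
        = f ∘ (fun e : {e : E // P e = i} => e.1) := by
      funext e
      obtain ⟨e, rfl⟩ := e
      exact hP e
    rw [heq]
    exact hli.comp (fun e : {e : E // P e = i} => e.1) Subtype.val_injective
end

section
/- Let a ≥ 0 and b ≥ 0 be integers and let G be a multigraph on a finite vertex set V with edge set E such that |E| = a|V| + b and G is (a,b)-sparse. Then there exists a map σ : E → V with σ(e) an endpoint of e for every edge e, such that for every nonempty U ⊆ V the number of edges e with σ(e) ∈ U is at most a|U| + b; moreover any such σ necessarily satisfies |σ⁻¹(v)| ≥ a for every vertex v. (Lemma: every (a,b)-tight multigraph is obtained by a sequence of loop-breaking operations from an (a,b)-sparse multigraph consisting of a|V| + b loops.) -/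
/-- A multigraph is given by maps `tail head : E → V` recording the two (possibly equal)
endpoints of each edge.  An edge set `F` is `(a,b)`-sparse if every nonempty `U ⊆ V`
spans at most `a|U| + b` edges of `F`. -/
def Sparse {V E : Type*} [DecidableEq V] [DecidableEq E] (tail head : E → V)
    (a : ℕ) (b : ℤ) (F : Finset E) : Prop :=
  ∀ U : Finset V, U.Nonempty →
    ((F.filter fun e => tail e ∈ U ∧ head e ∈ U).card : ℤ) ≤ a * U.card + b

/-- Lemma: `(a,b)`-tight multigraphs come from all-loop multigraphs by
loop breaking.  If `|E| = a|V| + b` and `G` is `(a,b)`-sparse then there is a choice map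
`σ : E → V`, sending each edge to one of its endpoints, such that for every nonempty
`U ⊆ V` at most `a|U| + b` edges are mapped into `U`; moreover any such `σ` has at least
`a` edges mapped to each vertex. -/
theorem stmt_4 {V E : Type*} [Fintype V] [DecidableEq V] [Fintype E] [DecidableEq E]
    (a b : ℕ) (tail head : E → V)
    (hcard : Fintype.card E = a * Fintype.card V + b)
    (hsp : Sparse tail head a (b : ℤ) Finset.univ) :
    (∃ σ : E → V, (∀ e, σ e = tail e ∨ σ e = head e) ∧
        ∀ U : Finset V, U.Nonempty →
          (Finset.univ.filter fun e => σ e ∈ U).card ≤ a * U.card + b) ∧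
      ∀ σ : E → V, (∀ e, σ e = tail e ∨ σ e = head e) →
        (∀ U : Finset V, U.Nonempty →
            (Finset.univ.filter fun e => σ e ∈ U).card ≤ a * U.card + b) →
        ∀ v : V, a ≤ (Finset.univ.filter fun e => σ e = v).card := by
  constructor
  · let t : V × Fin a → Finset E := fun p => Finset.univ.filter fun e => tail e = p.1 ∨ head e = p.1
    have hall : ∀ s : Finset (V × Fin a), s.card ≤ (s.biUnion t).card := by
      intro s
      let W : Finset V := s.image Prod.fst
      have h1 : s.card ≤ a * W.card := by
        have hsub : s ⊆ W ×ˢ (Finset.univ : Finset (Fin a)) := by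
          intro p hp
          simp only [Finset.mem_product, Finset.mem_univ, and_true]
          exact Finset.mem_image_of_mem _ hp
        have := Finset.card_le_card hsub
        rw [Finset.card_product, Finset.card_univ, Fintype.card_fin] at this
        rw [mul_comm]; exact this
      have h2 : (s.biUnion t)ᶜ = Finset.univ.filter fun e => tail e ∈ Wᶜ ∧ head e ∈ Wᶜ := by
        ext e
        simp only [Finset.mem_compl, Finset.mem_biUnion, t, W, Finset.mem_filter,
          Finset.mem_univ, true_and, Finset.mem_image]
        constructor
        · intro h
          exact ⟨fun ⟨p, hp, q⟩ => h ⟨p, hp, Or.inl q.symm⟩,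
            fun ⟨p, hp, q⟩ => h ⟨p, hp, Or.inr q.symm⟩⟩
        · rintro ⟨h, h'⟩ ⟨p, hp, q | q⟩
          · exact h ⟨p, hp, q.symm⟩
          · exact h' ⟨p, hp, q.symm⟩
      have h3 : (s.biUnion t)ᶜ.card ≤ a * Wᶜ.card + b := by
        rw [h2]
        rcases Finset.eq_empty_or_nonempty Wᶜ with h | h
        · rw [h]; simp
        · exact_mod_cast hsp _ h
      have h4 := Finset.card_add_card_compl (s.biUnion t)
      have h5 := Finset.card_add_card_compl W
      rw [hcard, ← h5, mul_add] at h4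
      omega
    obtain ⟨f, hf, hft⟩ := (Finset.all_card_le_biUnion_card_iff_exists_injective t).1 hall
    classical
    let σ : E → V := fun e => if h : ∃ p, f p = e then h.choose.1 else tail e
    have hσf : ∀ p, σ (f p) = p.1 := by
      intro p
      have h : ∃ q, f q = f p := ⟨p, rfl⟩
      simp only [σ, dif_pos h]
      rw [hf h.choose_spec]
    refine ⟨σ, ?_, ?_⟩
    · intro e
      by_cases h : ∃ p, f p = e
      · obtain ⟨p, rfl⟩ := h
        rw [hσf]
        have := hft p
        simp only [t, Finset.mem_filter, Finset.mem_univ, true_and] at this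
        exact this.imp Eq.symm Eq.symm
      · left; simp only [σ, dif_neg h]
    · intro U _
      have h1 : a * Uᶜ.card ≤ (Finset.univ.filter fun e => σ e ∈ U)ᶜ.card := by
        have hsub : (Uᶜ ×ˢ (Finset.univ : Finset (Fin a))).image f ⊆
            (Finset.univ.filter fun e => σ e ∈ U)ᶜ := by
          intro e he
          obtain ⟨p, hp, rfl⟩ := Finset.mem_image.1 he
          simp only [Finset.mem_product, Finset.mem_compl] at hp
          simp only [Finset.mem_compl, Finset.mem_filter, Finset.mem_univ, true_and, hσf]
          exact hp.1
        have := Finset.card_le_card hsub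
        rw [Finset.card_image_of_injective _ hf, Finset.card_product, Finset.card_univ,
          Fintype.card_fin, mul_comm] at this
        exact this
      have h4 := Finset.card_add_card_compl (Finset.univ.filter fun e => σ e ∈ U)
      have h5 := Finset.card_add_card_compl U
      rw [hcard, ← h5, mul_add] at h4
      omega
  · intro σ _ hσ v
    have h3 : (Finset.univ.filter fun e => σ e ∈ ({v} : Finset V)ᶜ).card
        ≤ a * ({v} : Finset V)ᶜ.card + b := by
      rcases Finset.eq_empty_or_nonempty ({v} : Finset V)ᶜ with h | h
      · rw [h]; simp
      · exact hσ _ h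
    have h2 : (Finset.univ.filter fun e => σ e ∈ ({v} : Finset V)ᶜ)
        = (Finset.univ.filter fun e => σ e = v)ᶜ := by
      ext e; simp
    rw [h2] at h3
    have h4 := Finset.card_add_card_compl (Finset.univ.filter fun e => σ e = v)
    have h5 := Finset.card_add_card_compl ({v} : Finset V)
    rw [hcard, ← h5, mul_add, Finset.card_singleton] at h4
    omega
end

section
/- Let a ≥ 0 and b ≥ 0 be integers and let G be a multigraph on a finite vertex set V with edge set E such that |E| = a|V| + b. Then G is (a,b)-sparse if and only if there exists a subset F ⊆ E with |F| = a|V| such that F is (a,0)-sparse (i.e., F is an (a,0)-tight spanning subgraph). -/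
/-- Corollary: `(a,b)`-sparsity via an `(a,0)`-tight spanning subgraph.
If `|E| = a|V| + b` (with `a, b ≥ 0`), then `G` is `(a,b)`-sparse iff it contains an edge
set `F` with `|F| = a|V|` that is `(a,0)`-sparse. -/
theorem stmt_5 {V E : Type*} [Fintype V] [DecidableEq V] [Fintype E] [DecidableEq E]
    (a b : ℕ) (tail head : E → V)
    (hcard : Fintype.card E = a * Fintype.card V + b) :
    Sparse tail head a (b : ℤ) Finset.univ ↔
      ∃ F : Finset E, F.card = a * Fintype.card V ∧ Sparse tail head a 0 F := by
  classical
  constructor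
  · intro h
    let t : E → Finset ((V × Fin a) ⊕ Fin b) := fun e =>
      (({tail e, head e} : Finset V) ×ˢ (Finset.univ : Finset (Fin a))).disjSum Finset.univ
    have hall : ∀ S : Finset E, S.card ≤ (S.biUnion t).card := by
      intro S
      rcases S.eq_empty_or_nonempty with rfl | ⟨e0, he0⟩
      · simp
      let U : Finset V := S.biUnion fun e => {tail e, head e}
      have hU : U.Nonempty := ⟨tail e0, by
        simp only [U, Finset.mem_biUnion]
        exact ⟨e0, he0, by simp⟩⟩
      have h1 := h U hU
      have h2 : S.card ≤ (Finset.univ.filter fun e => tail e ∈ U ∧ head e ∈ U).card := by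
        apply Finset.card_le_card
        intro e he
        simp only [Finset.mem_filter, Finset.mem_univ, true_and, U, Finset.mem_biUnion]
        exact ⟨⟨e, he, by simp⟩, ⟨e, he, by simp⟩⟩
      have h3 : (U ×ˢ (Finset.univ : Finset (Fin a))).disjSum (Finset.univ : Finset (Fin b))
          ⊆ S.biUnion t := by
        intro x hx
        rcases x with ⟨v, i⟩ | j
        · simp only [Finset.inl_mem_disjSum, Finset.mem_product, U, Finset.mem_biUnion] at hx
          obtain ⟨⟨e, he, hv⟩, -⟩ := hx
          simp only [Finset.mem_biUnion]
          refine ⟨e, he, ?_⟩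
          simp only [t, Finset.inl_mem_disjSum, Finset.mem_product]
          exact ⟨hv, Finset.mem_univ _⟩
        · simp only [Finset.mem_biUnion]
          exact ⟨e0, he0, by simp [t]⟩
      have h4 := Finset.card_le_card h3
      rw [Finset.card_disjSum, Finset.card_product, Finset.card_univ, Finset.card_univ,
        Fintype.card_fin, Fintype.card_fin, Nat.mul_comm] at h4
      have h5 : (Finset.univ.filter fun e => tail e ∈ U ∧ head e ∈ U).card
          ≤ a * U.card + b := by exact_mod_cast h1
      omega
    obtain ⟨f, hf, hft⟩ := (Finset.all_card_le_biUnion_card_iff_exists_injective t).1 hall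
    have hbij : Function.Bijective f := by
      rw [Fintype.bijective_iff_injective_and_card]
      refine ⟨hf, ?_⟩
      simp [hcard, Nat.mul_comm]
    let T : Finset ((V × Fin a) ⊕ Fin b) :=
      (Finset.univ : Finset (V × Fin a)).disjSum ∅
    refine ⟨Finset.univ.filter fun e => f e ∈ T, ?_, ?_⟩
    · have : (Finset.univ.filter fun e => f e ∈ T).card = T.card := by
        rw [← Finset.card_image_of_injective _ hf]
        congr 1
        ext x
        obtain ⟨e, rfl⟩ := hbij.2 x
        simp [hf.eq_iff]
      rw [this]
      simp [T, Nat.mul_comm]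
    · intro U _
      have : (((Finset.univ.filter fun e => f e ∈ T)).filter
          fun e => tail e ∈ U ∧ head e ∈ U).card
          ≤ ((U ×ˢ (Finset.univ : Finset (Fin a))).disjSum (∅ : Finset (Fin b))).card := by
        apply Finset.card_le_card_of_injOn f _ hf.injOn
        intro e he
        have he' := Finset.mem_filter.1 he
        have h1 := (Finset.mem_filter.1 he'.1).2
        obtain ⟨h2, h3⟩ := he'.2
        have h4 := hft e
        rcases hfe : f e with ⟨v, i⟩ | j
        · rw [hfe] at h4
          simp only [t, Finset.inl_mem_disjSum, Finset.mem_product, Finset.mem_insert,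
            Finset.mem_singleton] at h4
          rcases h4.1 with rfl | rfl <;> simp [h2, h3]
        · rw [hfe] at h1
          simp [T] at h1
      rw [Finset.card_disjSum, Finset.card_product, Finset.card_univ, Fintype.card_fin,
        Finset.card_empty, Nat.mul_comm] at this
      simpa using (by exact_mod_cast this : ((((Finset.univ.filter fun e => f e ∈ T)).filter
          fun e => tail e ∈ U ∧ head e ∈ U).card : ℤ) ≤ a * U.card + 0)
  · rintro ⟨F, hF, hs⟩ U hU
    have h1 := hs U hU
    have h2 : (Finset.univ.filter fun e => tail e ∈ U ∧ head e ∈ U) ⊆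
        (F.filter fun e => tail e ∈ U ∧ head e ∈ U) ∪ Fᶜ := by
      intro e he
      by_cases h : e ∈ F <;> simp_all
    have h3 := (Finset.card_le_card h2).trans (Finset.card_union_le _ _)
    rw [Finset.card_compl, hcard, hF, Nat.add_sub_cancel_left] at h3
    have h4 : ((Finset.univ.filter fun e => tail e ∈ U ∧ head e ∈ U).card : ℤ) ≤
      (F.filter fun e => tail e ∈ U ∧ head e ∈ U).card + b := by exact_mod_cast h3
    linarith
end

section
/- Fix d ≥ 1 and a multigraph on vertex set V = {1,…,n} with edge set E, and a presentation whose rigidity matrix has rank |E|. Suppose some edge e₀ ∈ E is a loop at a vertex j with q⁻(e₀) = 0, and write c₀ = c(e₀) and q₀ = q⁺(e₀). Let i ∈ V be any vertex. Then there exists an integer k₀ such that for every integer k ≥ k₀ the following modified presentation of the modified multigraph also has rigidity matrix of rank |E|: the loop e₀ is replaced by an edge with tail i and head j, its data is changed to lifting vector k·c₀, attachment q⁻(e₀) = 0 (on vertex i) and q⁺(e₀) = k·q₀ (on vertex j), and all other edges keep their data. (Loop breaking preserves minimal infinitesimal rigidity.) -/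
open Matrix

/-- The space of unknowns (infinitesimal motions) of a `d`-periodic body-and-bar framework
with `n` body orbits: a translation vector `ṗ_v ∈ ℝ^d` for each vertex, an (unrestricted)
matrix `B_v` for each vertex whose skew-symmetrization `B_v - B_vᵀ` plays the role of the
skew-symmetric rotation unknown `A_v`, and a matrix `Λ̇`. -/
abbrev RigDom (d n : ℕ) :=
  (Fin n → Fin d → ℝ) × (Fin n → Matrix (Fin d) (Fin d) ℝ) × Matrix (Fin d) (Fin d) ℝ

/-- The edge vector `h(e) = Λ c(e) + q⁺(e) − q⁻(e)` of an edge. -/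
noncomputable def edgeVec {E : Type*} (d : ℕ)
    (Λ : Matrix (Fin d) (Fin d) ℝ) (c : E → Fin d → ℤ) (qm qp : E → Fin d → ℝ)
    (e : E) : Fin d → ℝ :=
  Λ.mulVec (fun r => (c e r : ℝ)) + qp e - qm e

/-- The value of the row of the rigidity matrix indexed by the edge `e`, evaluated at the
vector of unknowns `x`:
`⟨Λ̇ c(e) + A_{head e} q⁺(e) − A_{tail e} q⁻(e) + ṗ_{head e} − ṗ_{tail e}, h(e)⟩`,
where `A_v := B_v - B_vᵀ` runs over all skew-symmetric matrices as `B_v` runs over all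
matrices. -/
noncomputable def rowVal {E : Type*} (d n : ℕ) (tail head : E → Fin n)
    (Λ : Matrix (Fin d) (Fin d) ℝ) (c : E → Fin d → ℤ) (qm qp : E → Fin d → ℝ)
    (x : RigDom d n) (e : E) : ℝ :=
  (x.2.2.mulVec (fun r => (c e r : ℝ))
      + (x.2.1 (head e) - (x.2.1 (head e))ᵀ).mulVec (qp e)
      - (x.2.1 (tail e) - (x.2.1 (tail e))ᵀ).mulVec (qm e)
      + x.1 (head e) - x.1 (tail e))
    ⬝ᵥ edgeVec d Λ c qm qp e

/-- The rank of the submatrix of the rigidity matrix formed by the rows indexed by `F`,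
i.e. the dimension of the image of the space of unknowns under the (linear) evaluation
map of those rows. -/
noncomputable def rigidityRank {E : Type*} (d n : ℕ) (tail head : E → Fin n)
    (Λ : Matrix (Fin d) (Fin d) ℝ) (c : E → Fin d → ℤ) (qm qp : E → Fin d → ℝ)
    (F : Finset E) : ℕ :=
  Module.finrank ℝ (Submodule.span ℝ
    (Set.range fun x : RigDom d n => fun e : F => rowVal d n tail head Λ c qm qp x e.1))

theorem rowVal_add' {E : Type*} (d n : ℕ) (tail head : E → Fin n)
    (Λ : Matrix (Fin d) (Fin d) ℝ) (c : E → Fin d → ℤ) (qm qp : E → Fin d → ℝ)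
    (x y : RigDom d n) (e : E) :
    rowVal d n tail head Λ c qm qp (x + y) e
      = rowVal d n tail head Λ c qm qp x e + rowVal d n tail head Λ c qm qp y e := by
  unfold rowVal
  rw [← add_dotProduct]
  congr 1
  simp only [Prod.fst_add, Prod.snd_add, Pi.add_apply, Matrix.transpose_add, Matrix.add_mulVec,
    Matrix.sub_mulVec]
  abel

theorem rowVal_smul' {E : Type*} (d n : ℕ) (tail head : E → Fin n)
    (Λ : Matrix (Fin d) (Fin d) ℝ) (c : E → Fin d → ℤ) (qm qp : E → Fin d → ℝ)
    (a : ℝ) (x : RigDom d n) (e : E) :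
    rowVal d n tail head Λ c qm qp (a • x) e = a * rowVal d n tail head Λ c qm qp x e := by
  unfold rowVal
  rw [← smul_eq_mul, ← smul_dotProduct]
  congr 1
  simp only [Prod.smul_fst, Prod.smul_snd, Pi.smul_apply, Matrix.transpose_smul,
    Matrix.sub_mulVec, Matrix.smul_mulVec, smul_add, smul_sub]

/-- The evaluation map of all the rows, as a linear map. -/
noncomputable def rowMap {E : Type*} (d n : ℕ) (tail head : E → Fin n)
    (Λ : Matrix (Fin d) (Fin d) ℝ) (c : E → Fin d → ℤ) (qm qp : E → Fin d → ℝ)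
    (F : Finset E) : RigDom d n →ₗ[ℝ] (F → ℝ) where
  toFun x := fun e => rowVal d n tail head Λ c qm qp x e.1
  map_add' x y := by
    funext e
    exact rowVal_add' d n tail head Λ c qm qp x y e.1
  map_smul' a x := by
    funext e
    exact rowVal_smul' d n tail head Λ c qm qp a x e.1

theorem rank_iff_surj {E : Type*} [Fintype E] (d n : ℕ) (tail head : E → Fin n)
    (Λ : Matrix (Fin d) (Fin d) ℝ) (c : E → Fin d → ℤ) (qm qp : E → Fin d → ℝ) :
    rigidityRank d n tail head Λ c qm qp Finset.univ = Fintype.card E ↔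
      ∀ y : E → ℝ, ∃ x, ∀ e, rowVal d n tail head Λ c qm qp x e = y e := by
  have h1 : Submodule.span ℝ (Set.range fun x : RigDom d n =>
      fun e : (Finset.univ : Finset E) => rowVal d n tail head Λ c qm qp x e.1)
      = LinearMap.range (rowMap d n tail head Λ c qm qp Finset.univ) :=
    Submodule.span_eq (LinearMap.range (rowMap d n tail head Λ c qm qp Finset.univ))
  have hc : Module.finrank ℝ (↥(Finset.univ : Finset E) → ℝ) = Fintype.card E := by
    simp
  unfold rigidityRank
  rw [h1, ← hc]
  constructor
  · intro h y
    have ht := Submodule.eq_top_of_finrank_eq h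
    obtain ⟨x, hx⟩ := LinearMap.range_eq_top.mp ht (fun e => y e.1)
    exact ⟨x, fun e => congrFun hx ⟨e, Finset.mem_univ e⟩⟩
  · intro h
    have ht : LinearMap.range (rowMap d n tail head Λ c qm qp Finset.univ) = ⊤ := by
      rw [LinearMap.range_eq_top]
      intro y
      obtain ⟨x, hx⟩ := h (fun e => y ⟨e, Finset.mem_univ e⟩)
      exact ⟨x, funext fun e => hx e.1⟩
    rw [ht, finrank_top]

/-- loop breaking preserves minimal infinitesimal rigidity.
Given a presentation of full rank `|E|` with a loop `e₀` at vertex `j` whose attachment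
`q⁻(e₀)` is the origin, and any vertex `i`, for all sufficiently large integers `k` the
presentation obtained by replacing the loop by an edge from `i` to `j` with lifting vector
`k·c(e₀)`, attachments `q⁻ = 0` and `q⁺ = k·q⁺(e₀)`, is again a presentation (all edge
vectors nonzero) of full rank `|E|`. -/
theorem stmt_6 {d n : ℕ} (hd : 1 ≤ d) {E : Type*} [Fintype E] [DecidableEq E]
    (tail head : E → Fin n)
    (Λ : Matrix (Fin d) (Fin d) ℝ) (c : E → Fin d → ℤ) (qm qp : E → Fin d → ℝ)
    (hΛ : IsUnit Λ) (hh : ∀ e, edgeVec d Λ c qm qp e ≠ 0)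
    (hrank : rigidityRank d n tail head Λ c qm qp Finset.univ = Fintype.card E)
    (e₀ : E) (j : Fin n) (htail : tail e₀ = j) (hhead : head e₀ = j)
    (hq : qm e₀ = 0) (i : Fin n) :
    ∃ k₀ : ℤ, ∀ k : ℤ, k₀ ≤ k →
      (∀ e, edgeVec d Λ (Function.update c e₀ fun r => k * c e₀ r)
          (Function.update qm e₀ 0)
          (Function.update qp e₀ fun r => (k : ℝ) * qp e₀ r) e ≠ 0) ∧
      rigidityRank d n (Function.update tail e₀ i) head Λ
          (Function.update c e₀ fun r => k * c e₀ r)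
          (Function.update qm e₀ 0)
          (Function.update qp e₀ fun r => (k : ℝ) * qp e₀ r)
          Finset.univ = Fintype.card E := by
  classical
  rw [rank_iff_surj] at hrank
  obtain ⟨u, hu⟩ := hrank (Pi.single e₀ 1)
  set h₀ := edgeVec d Λ c qm qp e₀ with hh₀
  obtain ⟨N, hN⟩ := exists_nat_gt |(u.1 j - u.1 i) ⬝ᵥ h₀|
  refine ⟨N + 1, fun k hk => ?_⟩
  have hkR : (N : ℝ) + 1 ≤ k := by exact_mod_cast hk
  have hN0 : (0 : ℝ) ≤ N := Nat.cast_nonneg N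
  have hkpos : (0 : ℝ) < k := by linarith
  have hcast : (fun r => ((k * c e₀ r : ℤ) : ℝ)) = (k : ℝ) • (fun r => (c e₀ r : ℝ)) := by
    funext r
    simp
  have hqk : (fun r => (k : ℝ) * qp e₀ r) = (k : ℝ) • qp e₀ := rfl
  have hv0 : edgeVec d Λ (Function.update c e₀ fun r => k * c e₀ r)
          (Function.update qm e₀ 0)
          (Function.update qp e₀ fun r => (k : ℝ) * qp e₀ r) e₀ = (k : ℝ) • h₀ := by
    rw [hh₀]
    unfold edgeVec
    simp only [Function.update_self]
    rw [hcast, hqk, hq, Matrix.mulVec_smul, sub_zero, sub_zero, smul_add]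
  have hv : ∀ e, e ≠ e₀ → edgeVec d Λ (Function.update c e₀ fun r => k * c e₀ r)
          (Function.update qm e₀ 0)
          (Function.update qp e₀ fun r => (k : ℝ) * qp e₀ r) e = edgeVec d Λ c qm qp e := by
    intro e he
    unfold edgeVec
    simp only [Function.update_of_ne he]
  have hr : ∀ x e, e ≠ e₀ → rowVal d n (Function.update tail e₀ i) head Λ
          (Function.update c e₀ fun r => k * c e₀ r)
          (Function.update qm e₀ 0)
          (Function.update qp e₀ fun r => (k : ℝ) * qp e₀ r) x e
          = rowVal d n tail head Λ c qm qp x e := by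
    intro x e he
    unfold rowVal
    rw [hv e he]
    simp only [Function.update_of_ne he]
  have hr0 : ∀ x, rowVal d n (Function.update tail e₀ i) head Λ
          (Function.update c e₀ fun r => k * c e₀ r)
          (Function.update qm e₀ 0)
          (Function.update qp e₀ fun r => (k : ℝ) * qp e₀ r) x e₀
          = k * (k * rowVal d n tail head Λ c qm qp x e₀ + (x.1 j - x.1 i) ⬝ᵥ h₀) := by
    intro x
    unfold rowVal
    rw [hv0, ← hh₀]
    simp only [Function.update_self]
    rw [hcast, hqk, hq, htail, hhead, Matrix.mulVec_smul, Matrix.mulVec_smul]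
    simp only [dotProduct_smul, smul_dotProduct, add_dotProduct, sub_dotProduct, smul_eq_mul,
      Matrix.mulVec_zero, zero_dotProduct]
    ring
  refine ⟨fun e => ?_, ?_⟩
  · by_cases he : e = e₀
    · subst he
      rw [hv0]
      exact smul_ne_zero hkpos.ne' (hh _)
    · rw [hv e he]
      exact hh e
  · rw [rank_iff_surj]
    intro y
    obtain ⟨x, hx⟩ := hrank y
    have hu0 : rowVal d n tail head Λ c qm qp u e₀ = 1 := by simpa using hu e₀
    have hD : (k : ℝ) * (k * 1 + (u.1 j - u.1 i) ⬝ᵥ h₀) ≠ 0 := by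
      have := neg_abs_le ((u.1 j - u.1 i) ⬝ᵥ h₀)
      have h2 : 0 < k * 1 + (u.1 j - u.1 i) ⬝ᵥ h₀ := by linarith
      positivity
    refine ⟨x + ((y e₀ - k * (k * y e₀ + (x.1 j - x.1 i) ⬝ᵥ h₀)) /
      (k * (k * 1 + (u.1 j - u.1 i) ⬝ᵥ h₀))) • u, fun e => ?_⟩
    rw [rowVal_add', rowVal_smul']
    by_cases he : e = e₀
    · rw [he, hr0, hr0, hx, hu0, div_mul_cancel₀ _ hD]
      ring
    · rw [hr x e he, hr u e he, hx, hu]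
      simp [he]
end

section
/- Fix d ≥ 1, a multigraph on vertex set V = {1,…,n} with edge set E, and any presentation. Then for every nonempty subset F ⊆ E, the rank of the submatrix of the rigidity matrix formed by the rows indexed by F is at most d(n_F − ω_F) + binom(d,2)·n_F + binom(d+1,2). In particular, if the rows indexed by F are linearly independent then |F| ≤ d(n_F − ω_F) + binom(d,2)·n_F + binom(d+1,2). (Necessary edge sparsity condition for periodic body-and-bar frameworks.) -/
open Matrix

/-- The set `V_F` of vertices incident to some edge of `F`. -/
def incVerts {V E : Type*} [DecidableEq V] (tail head : E → V) (F : Finset E) :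
    Finset V :=
  F.image tail ∪ F.image head

/-- Two vertices are adjacent through `F` if some edge of `F` joins them. -/
def adjRel {V E : Type*} (tail head : E → V) (F : Finset E) (u v : V) : Prop :=
  ∃ e ∈ F, (tail e = u ∧ head e = v) ∨ (tail e = v ∧ head e = u)

/-- `ω_F`: the number of connected components of the graph `(V_F, F)`. -/
noncomputable def numComp {V E : Type*} [DecidableEq V] (tail head : E → V)
    (F : Finset E) : ℕ :=
  Nat.card (Quot fun u v : {x : V // x ∈ incVerts tail head F} =>
    adjRel tail head F u.1 v.1)

/-- Skew-symmetric matrix from its off-diagonal parameters. -/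
noncomputable def skewOf (d : ℕ) (f : {z : Sym2 (Fin d) // ¬ z.IsDiag} → ℝ) :
    Matrix (Fin d) (Fin d) ℝ :=
  fun i j => if h : i = j then 0 else
    (if i < j then 1 else -1) * f ⟨s(i, j), by simpa using h⟩

/-- Symmetric matrix from its parameters. -/
noncomputable def symOf (d : ℕ) (f : Sym2 (Fin d) → ℝ) : Matrix (Fin d) (Fin d) ℝ :=
  fun i j => f s(i, j)

lemma skewOf_add (d : ℕ) (f g) : skewOf d (f + g) = skewOf d f + skewOf d g := by
  ext i j
  by_cases h : i = j <;> simp [skewOf, h, mul_add]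

lemma skewOf_smul (d : ℕ) (a : ℝ) (f) : skewOf d (a • f) = a • skewOf d f := by
  ext i j
  by_cases h : i = j <;> simp [skewOf, h, mul_left_comm]

lemma symOf_add (d : ℕ) (f g) : symOf d (f + g) = symOf d f + symOf d g := rfl

lemma symOf_smul (d : ℕ) (a : ℝ) (f) : symOf d (a • f) = a • symOf d f := rfl

lemma skewOf_surj (d : ℕ) (A : Matrix (Fin d) (Fin d) ℝ) (hA : Aᵀ = -A) :
    ∃ f, skewOf d f = A := by
  have hA' : ∀ i j, A j i = - A i j := fun i j => congrFun (congrFun hA i) j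
  refine ⟨fun z => A z.1.inf z.1.sup, ?_⟩
  ext i j
  by_cases h : i = j
  · subst h
    have := hA' i i
    simp [skewOf]
    linarith
  · rcases lt_or_gt_of_ne h with h1 | h1
    · simp [skewOf, h, h1, h1.le]
    · simp [skewOf, h, h1.not_gt, h1.le, hA' j i]

lemma symOf_surj (d : ℕ) (A : Matrix (Fin d) (Fin d) ℝ) (hA : Aᵀ = A) :
    ∃ f, symOf d f = A := by
  have hA' : ∀ i j, A j i = A i j := fun i j => congrFun (congrFun hA i) j
  refine ⟨fun z => A z.inf z.sup, ?_⟩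
  ext i j
  rcases le_total i j with h1 | h1
  · simp [symOf, h1]
  · simp [symOf, h1, hA' j i]

lemma skew_dot (d : ℕ) (A : Matrix (Fin d) (Fin d) ℝ) (hA : Aᵀ = -A) (h : Fin d → ℝ) :
    A.mulVec h ⬝ᵥ h = 0 := by
  have h1 : A.mulVec h ⬝ᵥ h = h ⬝ᵥ Aᵀ.mulVec h := by
    rw [Matrix.mulVec_transpose, dotProduct_comm, Matrix.dotProduct_mulVec, dotProduct_comm]
  rw [hA, Matrix.neg_mulVec, dotProduct_neg, dotProduct_comm h] at h1
  linarith

section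
variable {E : Type*} {n : ℕ} (tail head : E → Fin n) (F : Finset E)

lemma tail_mem (e : F) : tail e.1 ∈ incVerts tail head F :=
  Finset.mem_union_left _ (Finset.mem_image_of_mem _ e.2)

lemma head_mem (e : F) : head e.1 ∈ incVerts tail head F :=
  Finset.mem_union_right _ (Finset.mem_image_of_mem _ e.2)

/-- The coboundary map. -/
noncomputable def cobd : ({x // x ∈ incVerts tail head F} → ℝ) →ₗ[ℝ] (F → ℝ) where
  toFun f e := f ⟨head e.1, head_mem tail head F e⟩ - f ⟨tail e.1, tail_mem tail head F e⟩
  map_add' f g := by ext e; simp; ring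
  map_smul' a f := by ext e; simp; ring

lemma finrank_cobd :
    Module.finrank ℝ (LinearMap.range (cobd tail head F)) + numComp tail head F
      ≤ (incVerts tail head F).card := by
  classical
  have h1 := LinearMap.finrank_range_add_finrank_ker (cobd tail head F)
  let Q := Quot fun u v : {x // x ∈ incVerts tail head F} => adjRel tail head F u.1 v.1
  haveI : Finite Q := Quot.finite _
  letI : Fintype Q := Fintype.ofFinite Q
  let π : {x // x ∈ incVerts tail head F} → Q := Quot.mk _
  have hπ : Function.Surjective π := Quot.mk_surjective
  let P : (Q → ℝ) →ₗ[ℝ] LinearMap.ker (cobd tail head F) :=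
    (LinearMap.funLeft ℝ ℝ π).codRestrict _ (by
      intro g
      rw [LinearMap.mem_ker]
      ext e
      have : π ⟨head e.1, head_mem tail head F e⟩ = π ⟨tail e.1, tail_mem tail head F e⟩ :=
        Quot.sound ⟨e.1, e.2, Or.inr ⟨rfl, rfl⟩⟩
      simp [cobd, LinearMap.funLeft_apply, this])
  have hP : Function.Injective P := by
    intro a b hab
    have := congrArg Subtype.val hab
    exact LinearMap.funLeft_injective_of_surjective ℝ ℝ π hπ this
  have h2 := LinearMap.finrank_le_finrank_of_injective hP
  have h3 : numComp tail head F = Module.finrank ℝ (Q → ℝ) := by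
    rw [Module.finrank_fintype_fun_eq_card, ← Nat.card_eq_fintype_card]; rfl
  have h4 : Module.finrank ℝ ({x // x ∈ incVerts tail head F} → ℝ)
      = (incVerts tail head F).card := by
    rw [Module.finrank_fintype_fun_eq_card, Fintype.card_coe]
  omega

/-- The reduced rigidity map. -/
noncomputable def redMap (d : ℕ)
    (Λ : Matrix (Fin d) (Fin d) ℝ) (c : E → Fin d → ℤ) (qm qp : E → Fin d → ℝ) :
    ((Fin d → LinearMap.range (cobd tail head F)) ×
      ({x // x ∈ incVerts tail head F} → {z : Sym2 (Fin d) // ¬ z.IsDiag} → ℝ) ×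
      (Sym2 (Fin d) → ℝ)) →ₗ[ℝ] (F → ℝ) where
  toFun t e := ((symOf d t.2.2).mulVec (Λ.mulVec (fun r => (c e.1 r : ℝ)))
      + (skewOf d (t.2.1 ⟨head e.1, head_mem tail head F e⟩)).mulVec (qp e.1)
      - (skewOf d (t.2.1 ⟨tail e.1, tail_mem tail head F e⟩)).mulVec (qm e.1)
      + fun k => (t.1 k).1 e) ⬝ᵥ edgeVec d Λ c qm qp e.1
  map_add' x y := by
    ext e
    simp only [Prod.fst_add, Prod.snd_add, Pi.add_apply, symOf_add, skewOf_add,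
      Matrix.add_mulVec]
    rw [← add_dotProduct]
    congr 1
    ext k
    simp
    ring
  map_smul' a x := by
    ext e
    simp only [Prod.smul_fst, Prod.smul_snd, Pi.smul_apply, symOf_smul, skewOf_smul,
      Matrix.smul_mulVec, RingHom.id_apply]
    rw [← smul_dotProduct]
    congr 1
    ext k
    simp
    ring

lemma rowVal_mem (d : ℕ)
    (Λ : Matrix (Fin d) (Fin d) ℝ) (c : E → Fin d → ℤ) (qm qp : E → Fin d → ℝ)
    (hΛ : IsUnit Λ) (x : RigDom d n) :
    (fun e : F => rowVal d n tail head Λ c qm qp x e.1) ∈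
      LinearMap.range (redMap tail head F d Λ c qm qp) := by
  obtain ⟨p, B, L⟩ := x
  obtain ⟨M, hM⟩ : ∃ M : Matrix (Fin d) (Fin d) ℝ, M * Λ = L := by
    obtain ⟨u, rfl⟩ := hΛ
    exact ⟨L * (u⁻¹).val, by rw [mul_assoc, Units.inv_mul, mul_one]⟩
  set A : Matrix (Fin d) (Fin d) ℝ := (1 / 2 : ℝ) • (M - Mᵀ) with hA
  set S : Matrix (Fin d) (Fin d) ℝ := (1 / 2 : ℝ) • (M + Mᵀ) with hS
  have hAt : Aᵀ = -A := by
    ext i j; simp [hA]; ring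
  have hSt : Sᵀ = S := by
    ext i j; simp [hS]; ring
  have hMS : M = S + A := by
    ext i j; simp [hA, hS]; ring
  obtain ⟨s, hs⟩ := symOf_surj d S hSt
  have hk : ∀ v : {x // x ∈ incVerts tail head F},
      ∃ f, skewOf d f = (B v.1 - (B v.1)ᵀ) - A := by
    intro v
    apply skewOf_surj
    rw [Matrix.transpose_sub, hAt, Matrix.transpose_sub, Matrix.transpose_transpose]
    abel
  choose k hk using hk
  refine ⟨⟨fun i => ⟨cobd tail head F (fun v => p v.1 i), ⟨_, rfl⟩⟩, k, s⟩, ?_⟩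
  ext e
  have h0 := skew_dot d A hAt (edgeVec d Λ c qm qp e.1)
  simp only [redMap, rowVal, LinearMap.coe_mk, AddHom.coe_mk, hs, hk]
  rw [← sub_eq_zero, ← sub_dotProduct, ← neg_eq_zero, ← neg_dotProduct, ← h0]
  congr 1
  rw [← hM, hMS, ← Matrix.mulVec_mulVec]
  simp only [edgeVec, Matrix.add_mulVec, Matrix.sub_mulVec, Matrix.mulVec_add,
    Matrix.mulVec_sub]
  ext i
  simp [cobd]
  ring

lemma rank_bound (d : ℕ)
    (Λ : Matrix (Fin d) (Fin d) ℝ) (c : E → Fin d → ℤ) (qm qp : E → Fin d → ℝ)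
    (hΛ : IsUnit Λ) :
    rigidityRank d n tail head Λ c qm qp F ≤
      d * Module.finrank ℝ (LinearMap.range (cobd tail head F)) +
        ((incVerts tail head F).card * d.choose 2 + (d + 1).choose 2) := by
  classical
  have h1 : rigidityRank d n tail head Λ c qm qp F ≤
      Module.finrank ℝ (LinearMap.range (redMap tail head F d Λ c qm qp)) := by
    apply Submodule.finrank_mono
    rw [Submodule.span_le]
    rintro _ ⟨x, rfl⟩
    exact rowVal_mem tail head F d Λ c qm qp hΛ x
  refine (h1.trans (LinearMap.finrank_range_le _)).trans (le_of_eq ?_)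
  rw [Module.finrank_prod, Module.finrank_prod, Module.finrank_pi_fintype,
    Module.finrank_pi_fintype, Module.finrank_fintype_fun_eq_card,
    Module.finrank_fintype_fun_eq_card, Sym2.card, Sym2.card_subtype_not_diag]
  simp

end

/-- necessary edge sparsity for periodic body-and-bar frameworks.
For any presentation, the rank of the rows indexed by a nonempty `F ⊆ E` is at most
`d(n_F − ω_F) + C(d,2)·n_F + C(d+1,2)`; in particular if those rows are linearly
independent (rank equals `|F|`) then `|F|` obeys the same bound. -/
theorem stmt_7 {d n : ℕ} (hd : 1 ≤ d) {E : Type*} [Fintype E] [DecidableEq E]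
    (tail head : E → Fin n)
    (Λ : Matrix (Fin d) (Fin d) ℝ) (c : E → Fin d → ℤ) (qm qp : E → Fin d → ℝ)
    (hΛ : IsUnit Λ) (hh : ∀ e, edgeVec d Λ c qm qp e ≠ 0) :
    ∀ F : Finset E, F.Nonempty →
      ((rigidityRank d n tail head Λ c qm qp F : ℤ) ≤
          (d : ℤ) * ((incVerts tail head F).card - numComp tail head F)
            + (d.choose 2 : ℤ) * (incVerts tail head F).card + ((d + 1).choose 2 : ℤ)) ∧
        (rigidityRank d n tail head Λ c qm qp F = F.card →
          (F.card : ℤ) ≤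
            (d : ℤ) * ((incVerts tail head F).card - numComp tail head F)
              + (d.choose 2 : ℤ) * (incVerts tail head F).card + ((d + 1).choose 2 : ℤ)) := by
  intro F _
  have key : (rigidityRank d n tail head Λ c qm qp F : ℤ) ≤
      (d : ℤ) * ((incVerts tail head F).card - numComp tail head F)
        + (d.choose 2 : ℤ) * (incVerts tail head F).card + ((d + 1).choose 2 : ℤ) := by
    have h1 := rank_bound tail head F d Λ c qm qp hΛ
    have h2 := finrank_cobd tail head F
    zify at h1 h2
    have h3 : (d : ℤ) * (Module.finrank ℝ (LinearMap.range (cobd tail head F)) : ℤ) ≤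
        (d : ℤ) * ((incVerts tail head F).card - numComp tail head F) :=
      mul_le_mul_of_nonneg_left (by linarith) (by positivity)
    linarith
  exact ⟨key, fun h => by rw [← h]; exact key⟩
end

section
/- Let d ≥ 1 and let G be a multigraph on vertex set V = {1,…,n} with edge set E, |E| = binom(d+1,2)(n−1) + d². Suppose E contains two disjoint subsets F₁ and F₂ such that F₁ is (d,d)-tight (|F₁| = dn − d) and F₂ is (binom(d,2), 0)-tight (|F₂| = binom(d,2)·n). Then there exists a presentation of G whose rigidity matrix has rank |E|. (Sufficiency direction of the Maxwell–Laman characterization for periodic body-and-bar frameworks.) -/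
open Matrix

/-- An edge set `F` is `(a,b)`-tight if it is `(a,b)`-sparse and `|F| = a|V| + b`. -/
def Tight {V E : Type*} [Fintype V] [DecidableEq V] [DecidableEq E] (tail head : E → V)
    (a : ℕ) (b : ℤ) (F : Finset E) : Prop :=
  Sparse tail head a b F ∧ (F.card : ℤ) = a * Fintype.card V + b

theorem pb_rado {M : Type*} [AddCommGroup M] [Module ℝ M] [FiniteDimensional ℝ M] [DecidableEq M]
    {ι : Type*} [Fintype ι] [DecidableEq ι] (N : ℕ) : ∀ (A : ι → Finset M),
    ∑ i, (A i).card = N →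
    (∀ I : Finset ι, I.card ≤ Module.finrank ℝ (Submodule.span ℝ ((I.biUnion A : Finset M) : Set M))) →
    ∃ f : ι → M, (∀ i, f i ∈ A i) ∧ LinearIndependent ℝ f := by
  induction N using Nat.strong_induction_on with
  | _ N ih =>
  intro A hN hA
  by_cases hc : ∀ i, (A i).card ≤ 1
  · have hne : ∀ i, ∃ x, A i = {x} := by
      intro i
      have h1 := hA {i}
      rw [← Finset.card_eq_one]
      have h2 := finrank_span_finset_le_card (R := ℝ) (A i)
      rw [Finset.card_singleton, Finset.singleton_biUnion] at h1
      have := hc i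
      have h3 : Module.finrank ℝ (Submodule.span ℝ (A i : Set M)) ≤ (A i).card := h2
      omega
    choose f hf using hne
    refine ⟨f, fun i => by simp [hf i], ?_⟩
    rw [linearIndependent_iff_card_le_finrank_span]
    have h1 := hA Finset.univ
    have : ((Finset.univ.biUnion A : Finset M) : Set M) = Set.range f := by
      ext x; simp [hf, eq_comm]
    rw [this] at h1
    exact h1
  · push Not at hc
    obtain ⟨i0, hi0⟩ := hc
    obtain ⟨x, hx, y, hy, hxy⟩ := Finset.one_lt_card.mp hi0
    have key : ∀ z ∈ A i0, (¬ ∃ f : ι → M, (∀ i, f i ∈ A i) ∧ LinearIndependent ℝ f) →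
        ∃ I : Finset ι, i0 ∈ I ∧ Module.finrank ℝ (Submodule.span ℝ
          ((I.biUnion (Function.update A i0 ((A i0).erase z)) : Finset M) : Set M)) < I.card := by
      intro z hz hno
      by_contra hcon
      push Not at hcon
      apply hno
      obtain ⟨f, hf, hli⟩ := ih (∑ i, (Function.update A i0 ((A i0).erase z) i).card) (by
          rw [← hN]
          apply Finset.sum_lt_sum
          · intro i _
            by_cases h : i = i0
            · subst h; simp [Finset.card_erase_le]
            · simp [h]
          · exact ⟨i0, Finset.mem_univ _, by simpa using Finset.card_erase_lt_of_mem hz⟩)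
        (Function.update A i0 ((A i0).erase z)) rfl (by
          intro I
          by_cases h : i0 ∈ I
          · exact hcon I h
          · have : I.biUnion (Function.update A i0 ((A i0).erase z)) = I.biUnion A := by
              apply Finset.biUnion_congr rfl
              intro i hi
              have : i ≠ i0 := fun h' => h (h' ▸ hi)
              simp [this]
            rw [this]; exact hA I)
      refine ⟨f, fun i => ?_, hli⟩
      have := hf i
      by_cases h : i = i0
      · subst h; simp at this; exact this.2
      · simpa [h] using this
    by_contra hno
    obtain ⟨I, hI0, hI⟩ := key x hx hno
    obtain ⟨J, hJ0, hJ⟩ := key y hy hno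
    set P := Submodule.span ℝ
          ((I.biUnion (Function.update A i0 ((A i0).erase x)) : Finset M) : Set M) with hP
    set Q := Submodule.span ℝ
          ((J.biUnion (Function.update A i0 ((A i0).erase y)) : Finset M) : Set M) with hQ
    have memP : ∀ i ∈ I, ∀ m ∈ A i, (i = i0 → m ≠ x) → m ∈ P := by
      intro i hi m hm h
      apply Submodule.subset_span
      simp only [Finset.coe_biUnion, Set.mem_iUnion]
      refine ⟨i, hi, ?_⟩
      by_cases h' : i = i0
      · subst h'; simp [hm, h rfl]
      · simpa [h'] using hm
    have memQ : ∀ i ∈ J, ∀ m ∈ A i, (i = i0 → m ≠ y) → m ∈ Q := by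
      intro i hi m hm h
      apply Submodule.subset_span
      simp only [Finset.coe_biUnion, Set.mem_iUnion]
      refine ⟨i, hi, ?_⟩
      by_cases h' : i = i0
      · subst h'; simp [hm, h rfl]
      · simpa [h'] using hm
    have h1 : Submodule.span ℝ (((I ∪ J).biUnion A : Finset M) : Set M) ≤ P ⊔ Q := by
      rw [Submodule.span_le]
      intro m hm
      simp only [Finset.coe_biUnion, Set.mem_iUnion, Finset.mem_coe, Finset.mem_union] at hm
      obtain ⟨i, hi, hm⟩ := hm
      by_cases h' : i = i0
      · subst h'
        by_cases hmx : m = x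
        · exact Submodule.mem_sup_right (memQ i hJ0 m hm (fun _ => hmx ▸ hxy))
        · exact Submodule.mem_sup_left (memP i hI0 m hm (fun _ => hmx))
      · rcases hi with hi | hi
        · exact Submodule.mem_sup_left (memP i hi m hm (fun h => absurd h h'))
        · exact Submodule.mem_sup_right (memQ i hi m hm (fun h => absurd h h'))
    have h2 : Submodule.span ℝ ((((I ∩ J).erase i0).biUnion A : Finset M) : Set M) ≤ P ⊓ Q := by
      rw [Submodule.span_le]
      intro m hm
      simp only [Finset.coe_biUnion, Set.mem_iUnion, Finset.mem_coe, Finset.mem_erase,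
        Finset.mem_inter] at hm
      obtain ⟨i, ⟨h', hi, hj⟩, hm⟩ := hm
      exact ⟨memP i hi m hm (fun h => absurd h h'), memQ i hj m hm (fun h => absurd h h')⟩
    have e1 := (hA _).trans (Submodule.finrank_mono h1)
    have e2 := (hA _).trans (Submodule.finrank_mono h2)
    have e3 := Submodule.finrank_sup_add_finrank_inf_eq P Q
    have e4 := Finset.card_union_add_card_inter I J
    rw [Finset.card_erase_of_mem (Finset.mem_inter.mpr ⟨hI0, hJ0⟩)] at e2
    omega

/-- Lower bound of the rank of the edge vectors. -/
theorem pb_rank {d n : ℕ} {E : Type*} [DecidableEq E] (tail head : E → Fin n) (F I : Finset E)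
    (hIF : I ⊆ F)
    (hS : ∀ U : Finset (Fin n), U.Nonempty →
      ((F.filter fun e => tail e ∈ U ∧ head e ∈ U).card : ℤ) ≤ d * U.card + (-(d : ℤ)))
    (S : Submodule ℝ (Fin n × Fin d → ℝ))
    (h : ∀ e ∈ I, ∀ k, (Pi.single (head e, k) 1 - Pi.single (tail e, k) 1 : Fin n × Fin d → ℝ) ∈ S) :
    I.card ≤ Module.finrank ℝ S := by
  classical
  let δ : Fin n → Fin d → (Fin n × Fin d → ℝ) := fun v k => Pi.single (v, k) 1
  let s : Setoid (Fin n) :=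
    { r := fun v w => ∀ k, δ v k - δ w k ∈ S
      iseqv := ⟨fun v k => by simp, fun {v w} h k => by
          have := S.neg_mem (h k); simpa using this,
        fun {u v w} h1 h2 k => by
          have := S.add_mem (h1 k) (h2 k); simpa using this⟩ }
  have hs : ∀ e ∈ I, (Quotient.mk s (head e)) = Quotient.mk s (tail e) :=
    fun e he => Quotient.sound (h e he)
  let T : Submodule ℝ (Fin n × Fin d → ℝ) :=
    Submodule.span ℝ (Set.range fun p : Quotient s × Fin d => δ p.1.out p.2)
  have hT : Module.finrank ℝ T ≤ Fintype.card (Quotient s) * d := by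
    have := finrank_range_le_card (R := ℝ) (fun p : Quotient s × Fin d => δ p.1.out p.2)
    simpa [Set.finrank, T] using this
  have htop : S ⊔ T = ⊤ := by
    rw [eq_top_iff]
    intro f _
    have hf : f = ∑ p : Fin n × Fin d, f p • δ p.1 p.2 := by
      ext q
      simp [δ, Finset.sum_apply, Pi.single_apply]
    rw [hf]
    refine Submodule.sum_mem _ fun p _ => Submodule.smul_mem _ _ ?_
    have h1 : δ p.1 p.2 - δ (Quotient.mk s p.1).out p.2 ∈ S := by
      have : s.r p.1 (Quotient.mk s p.1).out := s.symm (Quotient.mk_out p.1)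
      exact this p.2
    have h2 : δ (Quotient.mk s p.1).out p.2 ∈ T := Submodule.subset_span ⟨(_, p.2), rfl⟩
    have := Submodule.add_mem _ (Submodule.mem_sup_left (T := T) h1) (Submodule.mem_sup_right (S := S) h2)
    simpa using this
  have hdim : n * d ≤ Module.finrank ℝ S + Module.finrank ℝ T := by
    have := Submodule.finrank_add_le_finrank_add_finrank S T
    rw [htop, finrank_top] at this
    simpa using this
  let U : Quotient s → Finset (Fin n) := fun q => Finset.univ.filter fun v => Quotient.mk s v = q
  have hUsum : ∑ q, (U q).card = n := by
    have := Finset.card_eq_sum_card_fiberwise (f := fun v : Fin n => Quotient.mk s v)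
      (s := Finset.univ) (t := Finset.univ) (by simp)
    simpa [U] using this.symm
  have hIsum : I.card = ∑ q, (I.filter fun e => Quotient.mk s (head e) = q).card :=
    Finset.card_eq_sum_card_fiberwise (by simp)
  have hle : ∀ q, ((I.filter fun e => Quotient.mk s (head e) = q).card : ℤ)
      ≤ d * (U q).card + (-(d : ℤ)) := by
    intro q
    refine le_trans ?_ (hS (U q) ⟨q.out, by simp [U]⟩)
    norm_cast
    apply Finset.card_le_card
    intro e he
    simp only [Finset.mem_filter] at he ⊢
    refine ⟨hIF he.1, ?_, ?_⟩
    · simp [U, ← hs e he.1, he.2]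
    · simp [U, he.2]
  have htot : (I.card : ℤ) ≤ d * n + (Fintype.card (Quotient s)) * (-(d : ℤ)) := by
    have h0 : ∑ q, (d * ((U q).card : ℤ) + (-(d : ℤ))) =
        d * n + (Fintype.card (Quotient s)) * (-(d : ℤ)) := by
      rw [Finset.sum_add_distrib, ← Finset.mul_sum]
      have : ∑ q, ((U q).card : ℤ) = n := by exact_mod_cast hUsum
      rw [this]; simp
    rw [← h0, hIsum]
    push_cast
    exact Finset.sum_le_sum fun q _ => hle q
  zify at hT hdim ⊢
  linarith

theorem pb_F1 {d n : ℕ} {E : Type*} [DecidableEq E] (tail head : E → Fin n) (F : Finset E)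
    (hS : ∀ U : Finset (Fin n), U.Nonempty →
      ((F.filter fun e => tail e ∈ U ∧ head e ∈ U).card : ℤ) ≤ d * U.card + (-(d : ℤ))) :
    ∃ k : F → Fin d, ∀ t : F → ℝ, ∃ p : Fin n → Fin d → ℝ,
      ∀ e : F, p (head e) (k e) - p (tail e) (k e) = t e := by
  classical
  obtain ⟨f, hf, hli⟩ := pb_rado (M := Fin n × Fin d → ℝ) (ι := F) _
    (fun e => Finset.univ.image fun k : Fin d =>
      (Pi.single (head e.1, k) 1 - Pi.single (tail e.1, k) 1 : Fin n × Fin d → ℝ)) rfl (by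
    intro I
    rw [← Finset.card_map (Function.Embedding.subtype _)]
    apply pb_rank tail head F _ _ hS
    · intro e he k
      simp only [Finset.mem_map, Function.Embedding.subtype_apply] at he
      obtain ⟨a, ha, rfl⟩ := he
      apply Submodule.subset_span
      simp only [Finset.mem_coe, Finset.mem_biUnion, Finset.mem_image, Finset.mem_univ, true_and]
      exact ⟨a, ha, k, rfl⟩
    · intro e he
      simp only [Finset.mem_map, Function.Embedding.subtype_apply] at he
      obtain ⟨a, ha, rfl⟩ := he
      exact a.2)
  simp only [Finset.mem_image, Finset.mem_univ, true_and] at hf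
  choose k hk using hf
  refine ⟨k, fun t => ?_⟩
  obtain ⟨φ, hφ⟩ := LinearMap.exists_extend ((Finsupp.linearCombination ℝ t).comp hli.repr)
  refine ⟨fun v k => φ (Pi.single (v, k) 1), fun e => ?_⟩
  rw [← map_sub, hk]
  have h1 := LinearMap.congr_fun hφ ⟨f e, Submodule.subset_span ⟨e, rfl⟩⟩
  simp only [LinearMap.comp_apply, Submodule.subtype_apply] at h1
  rw [h1, hli.repr_eq_single e _ rfl]
  simp

abbrev PbLt (d : ℕ) := {p : Fin d × Fin d // p.1 < p.2}
abbrev PbLe (d : ℕ) := {p : Fin d × Fin d // p.1 ≤ p.2}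

theorem pb_card_le (d : ℕ) : Fintype.card (PbLe d) = (d + 1).choose 2 := by
  have := Fintype.card_congr (Sym2.sortEquiv (α := Fin d))
  rw [← this, Sym2.card]; simp

theorem pb_card_lt (d : ℕ) : Fintype.card (PbLt d) = d.choose 2 := by
  have h1 := pb_card_le d
  have h2 : Fintype.card (PbLe d) = Fintype.card (PbLt d) + d := by
    have e : PbLe d ≃ PbLt d ⊕ Fin d :=
      { toFun := fun p => if h : p.1.1 < p.1.2 then Sum.inl ⟨p.1, h⟩ else Sum.inr p.1.1
        invFun := Sum.elim (fun p => ⟨p.1, p.2.le⟩) (fun a => ⟨(a, a), le_refl _⟩)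
        left_inv := by
          rintro ⟨⟨a, b⟩, h⟩
          by_cases h' : a < b
          · simp [h']
          · have : a = b := le_antisymm h (not_lt.mp h')
            subst this; simp
        right_inv := by
          rintro (⟨⟨a, b⟩, h⟩ | a)
          · have h' : a < b := h
            simp [h']
          · simp }
    rw [Fintype.card_congr e]; simp
  have h3 : (d + 1).choose 2 = d + d.choose 2 := by
    rw [Nat.choose_succ_succ' d 1]; simp
  omega

theorem pb_F2 {d n : ℕ} {E : Type*} [DecidableEq E] (tail head : E → Fin n) (F : Finset E)
    (hS : ∀ U : Finset (Fin n), U.Nonempty →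
      ((F.filter fun e => tail e ∈ U ∧ head e ∈ U).card : ℤ) ≤ (d.choose 2 : ℕ) * U.card + 0) :
    ∃ g : F → Fin n × PbLt d, Function.Injective g ∧ ∀ e : F, (g e).1 = tail e ∨ (g e).1 = head e := by
  classical
  have := (Finset.all_card_le_biUnion_card_iff_exists_injective
    (fun e : F => ({tail e.1, head e.1} : Finset (Fin n)) ×ˢ (Finset.univ : Finset (PbLt d)))).mp (by
    intro I
    rcases I.eq_empty_or_nonempty with rfl | ⟨e0, he0⟩
    · simp
    have : I.biUnion (fun e : F => ({tail e.1, head e.1} : Finset (Fin n)) ×ˢ (Finset.univ : Finset (PbLt d)))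
      = (I.biUnion fun e : F => ({tail e.1, head e.1} : Finset (Fin n))) ×ˢ (Finset.univ : Finset (PbLt d)) := by
      ext ⟨v, p⟩; simp
    rw [this, Finset.card_product, Finset.card_univ, pb_card_lt]
    set U := (I.biUnion fun e : F => ({tail e.1, head e.1} : Finset (Fin n))) with hU
    have h1 := hS U ⟨tail e0, by simp only [hU, Finset.mem_biUnion]; exact ⟨e0, he0, by simp⟩⟩
    rw [← Finset.card_map (Function.Embedding.subtype _)]
    have h2 : (I.map (Function.Embedding.subtype _)).card ≤ (F.filter fun e => tail e ∈ U ∧ head e ∈ U).card := by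
      apply Finset.card_le_card
      intro e he
      simp only [Finset.mem_map, Function.Embedding.subtype_apply] at he
      obtain ⟨a, ha, rfl⟩ := he
      simp only [Finset.mem_filter, hU, Finset.mem_biUnion]
      exact ⟨a.2, ⟨a, ha, by simp⟩, ⟨a, ha, by simp⟩⟩
    refine h2.trans ?_
    zify
    linarith)
  obtain ⟨g, hg, hm⟩ := this
  refine ⟨g, hg, fun e => ?_⟩
  have := hm e
  simpa using this

theorem pb_S {d : ℕ} {ι : Type*} (g : ι → PbLe d) (hg : Function.Injective g) (τ : ι → ℝ) :
    ∃ S : Matrix (Fin d) (Fin d) ℝ, ∀ e,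
      (S.mulVec (Pi.single (g e).1.1 1 + Pi.single (g e).1.2 1)) ⬝ᵥ
        (Pi.single (g e).1.1 1 + Pi.single (g e).1.2 1) = τ e := by
  classical
  obtain ⟨σ, hσ⟩ : ∃ σ : Fin d → Fin d → ℝ, ∀ e, σ (g e).1.1 (g e).1.2 = τ e := by
    refine ⟨fun a b => if h : ∃ e, (g e).1 = (a, b) then τ h.choose else 0, fun e => ?_⟩
    have h : ∃ ee, (g ee).1 = ((g e).1.1, (g e).1.2) := ⟨e, rfl⟩
    have hsp := h.choose_spec
    simp only [h, dif_pos]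
    congr 1
    exact hg (Subtype.ext hsp)
  refine ⟨Matrix.of fun a b => if a = b then σ a a / 4 else
    if a < b then σ a b - σ a a / 4 - σ b b / 4 else 0, fun e => ?_⟩
  rw [← hσ e]
  have hle := (g e).2
  generalize (g e).1.1 = a at hle ⊢
  generalize (g e).1.2 = b at hle ⊢
  rw [Matrix.mulVec_add]
  simp only [Matrix.mulVec_single_one, dotProduct_add, add_dotProduct, dotProduct_single,
    Matrix.col_apply, mul_one, Matrix.of_apply]
  rcases hle.lt_or_eq with h | h
  · have h1 : a ≠ b := h.ne
    have h2 : ¬ b < a := h.not_gt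
    simp [h, h1, h1.symm, h2]
    ring
  · subst h
    simp; ring

theorem pb_B {d n : ℕ} {ι : Type*} (g : ι → Fin n × PbLt d) (hg : Function.Injective g)
    (τ : ι → ℝ) :
    ∃ B : Fin n → Matrix (Fin d) (Fin d) ℝ, ∀ e,
      (B (g e).1 - (B (g e).1)ᵀ) (g e).2.1.1 (g e).2.1.2 = τ e := by
  classical
  refine ⟨fun v => Matrix.of fun a b =>
      if h : ∃ e, (g e).1 = v ∧ (g e).2.1 = (a, b) then τ h.choose else 0,
    fun e => ?_⟩
  have h : ∃ ee, (g ee).1 = (g e).1 ∧ (g ee).2.1 = ((g e).2.1.1, (g e).2.1.2) := ⟨e, rfl, rfl⟩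
  have hsp := h.choose_spec
  have h2 : ¬ ∃ ee, (g ee).1 = (g e).1 ∧ (g ee).2.1 = ((g e).2.1.2, (g e).2.1.1) := by
    rintro ⟨ee, -, h3⟩
    have h4 := (g ee).2.2
    rw [h3] at h4
    exact absurd h4 (g e).2.2.not_gt
  simp only [Matrix.sub_apply, Matrix.transpose_apply, Matrix.of_apply]
  rw [dif_pos h, dif_neg h2, sub_zero]
  congr 1
  exact hg (Prod.ext hsp.1 (Subtype.ext hsp.2))

/-- sufficiency in the Maxwell–Laman characterization for periodic
body-and-bar frameworks.  If `|E| = C(d+1,2)(n−1) + d²` and `E` contains two disjoint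
edge sets, one `(d,d)`-tight (`|F₁| = dn − d`) and one `(C(d,2),0)`-tight
(`|F₂| = C(d,2)·n`), then some presentation has rigidity matrix of full rank `|E|`. -/
theorem stmt_9 {d n : ℕ} (hd : 1 ≤ d) (hn : 1 ≤ n) {E : Type*} [Fintype E] [DecidableEq E]
    (tail head : E → Fin n)
    (hE : Fintype.card E + (d + 1).choose 2 = (d + 1).choose 2 * n + d ^ 2)
    (F₁ F₂ : Finset E) (hdisj : Disjoint F₁ F₂)
    (hF₁ : Tight tail head d (-(d : ℤ)) F₁)
    (hF₂ : Tight tail head (d.choose 2) 0 F₂) :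
    ∃ (Λ : Matrix (Fin d) (Fin d) ℝ) (c : E → Fin d → ℤ) (qm qp : E → Fin d → ℝ),
      IsUnit Λ ∧ (∀ e, edgeVec d Λ c qm qp e ≠ 0) ∧
      rigidityRank d n tail head Λ c qm qp Finset.univ = Fintype.card E := by
  classical
  obtain ⟨hS₁, hc₁⟩ := hF₁
  obtain ⟨hS₂, hc₂⟩ := hF₂
  obtain ⟨k, hk⟩ := pb_F1 tail head F₁ hS₁
  obtain ⟨g, hg, hgv⟩ := pb_F2 tail head F₂ hS₂
  let F₃ : Finset E := (F₁ ∪ F₂)ᶜ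
  have hF₃ : Fintype.card F₃ ≤ Fintype.card (PbLe d) := by
    rw [pb_card_le, Fintype.card_coe]
    have h1 : F₃.card + (F₁ ∪ F₂).card = Fintype.card E := Finset.card_compl_add_card _
    rw [Finset.card_union_of_disjoint hdisj] at h1
    have h3 : (d + 1).choose 2 = d + d.choose 2 := by
      rw [Nat.choose_succ_succ' d 1]; simp
    have h4 : d ^ 2 = d + 2 * d.choose 2 := by
      have h6 : (d + 1).choose 2 * 2 = (d + 1) * d := by
        rw [Nat.choose_two_right, Nat.add_sub_cancel]
        exact Nat.div_mul_cancel (by simpa [mul_comm] using (Nat.even_mul_succ_self d).two_dvd)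
      nlinarith
    rw [h3] at hE ⊢
    simp only [Fintype.card_fin] at hc₁ hc₂
    zify at hE h1 h4 ⊢
    nlinarith
  obtain ⟨g₃⟩ := Function.Embedding.nonempty_of_card_le hF₃
  have hdata : ∀ e : E, ∃ (c : Fin d → ℤ) (qm qp : Fin d → ℝ),
      (∀ h : e ∈ F₁, c = 0 ∧ qm = 0 ∧ qp = Pi.single (k ⟨e, h⟩) 1) ∧
      (∀ h : e ∈ F₂, c = Pi.single (g ⟨e, h⟩).2.1.1 1 ∧
        (((g ⟨e, h⟩).1 = head e ∧ qm = 0 ∧ qp = Pi.single (g ⟨e, h⟩).2.1.2 1) ∨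
         ((g ⟨e, h⟩).1 = tail e ∧ qp = 0 ∧ qm = Pi.single (g ⟨e, h⟩).2.1.2 1))) ∧
      (∀ h : e ∈ F₃, c = Pi.single (g₃ ⟨e, h⟩).1.1 1 + Pi.single (g₃ ⟨e, h⟩).1.2 1 ∧
        qm = 0 ∧ qp = 0) := by
    intro e
    by_cases h1 : e ∈ F₁
    · have h2 : e ∉ F₂ := Finset.disjoint_left.mp hdisj h1
      have h3 : e ∉ F₃ := by simp [F₃, h1]
      exact ⟨0, 0, Pi.single (k ⟨e, h1⟩) 1, fun _ => ⟨rfl, rfl, rfl⟩, fun h => absurd h h2, fun h => absurd h h3⟩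
    · by_cases h2 : e ∈ F₂
      · have h3 : e ∉ F₃ := by simp [F₃, h2]
        rcases hgv ⟨e, h2⟩ with hv | hv
        · exact ⟨Pi.single (g ⟨e, h2⟩).2.1.1 1, Pi.single (g ⟨e, h2⟩).2.1.2 1, 0,
            fun h => absurd h h1, fun _ => ⟨rfl, Or.inr ⟨hv, rfl, rfl⟩⟩,
            fun h => absurd h h3⟩
        · exact ⟨Pi.single (g ⟨e, h2⟩).2.1.1 1, 0, Pi.single (g ⟨e, h2⟩).2.1.2 1,
            fun h => absurd h h1, fun _ => ⟨rfl, Or.inl ⟨hv, rfl, rfl⟩⟩,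
            fun h => absurd h h3⟩
      · have h3 : e ∈ F₃ := by simp [F₃, h1, h2]
        exact ⟨Pi.single (g₃ ⟨e, h3⟩).1.1 1 + Pi.single (g₃ ⟨e, h3⟩).1.2 1, 0, 0,
          fun h => absurd h h1, fun h => absurd h h2, fun _ => ⟨rfl, rfl, rfl⟩⟩
  choose c qm qp hd1 hd2 hd3 using hdata
  have hcast1 : ∀ a : Fin d, (fun r => (((Pi.single a 1 : Fin d → ℤ) r : ℤ) : ℝ)) = Pi.single a 1 := by
    intro a; ext r; by_cases h : r = a <;> simp [Pi.single_apply, h]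
  have hcast2 : ∀ a b : Fin d, (fun r => (((Pi.single a 1 + Pi.single b 1 : Fin d → ℤ) r : ℤ) : ℝ))
      = Pi.single a 1 + Pi.single b 1 := by
    intro a b
    rw [← hcast1 a, ← hcast1 b]; ext r; simp
  have hcast0 : (fun r : Fin d => (((0 : Fin d → ℤ) r : ℤ) : ℝ)) = 0 := by ext r; simp
  have hv1 : ∀ e (h : e ∈ F₁), edgeVec d 1 c qm qp e = Pi.single (k ⟨e, h⟩) 1 := by
    intro e h
    obtain ⟨a1, a2, a3⟩ := hd1 e h
    simp only [edgeVec, a1, a2, a3, hcast0]; simp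
  have hv3 : ∀ e (h : e ∈ F₃), edgeVec d 1 c qm qp e =
      Pi.single (g₃ ⟨e, h⟩).1.1 1 + Pi.single (g₃ ⟨e, h⟩).1.2 1 := by
    intro e h
    obtain ⟨a1, a2, a3⟩ := hd3 e h
    simp only [edgeVec, a1, a2, a3, hcast2]; simp
  have hv2 : ∀ e (h : e ∈ F₂), edgeVec d 1 c qm qp e =
      Pi.single (g ⟨e, h⟩).2.1.1 1 + qp e - qm e := by
    intro e h
    obtain ⟨a1, -⟩ := hd2 e h
    simp only [edgeVec, a1, hcast1, Matrix.one_mulVec]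
  have hmem : ∀ e, e ∈ F₁ ∨ e ∈ F₂ ∨ e ∈ F₃ := by
    intro e
    by_cases h1 : e ∈ F₁ <;> by_cases h2 : e ∈ F₂ <;> simp [F₃, h1, h2]
  refine ⟨1, c, qm, qp, isUnit_one, ?_, ?_⟩
  · intro e h0
    rcases hmem e with h | h | h
    · rw [hv1 e h] at h0
      have := congrFun h0 (k ⟨e, h⟩)
      simp at this
    · rw [hv2 e h] at h0
      have := congrFun h0 (g ⟨e, h⟩).2.1.1
      have hne : (g ⟨e, h⟩).2.1.1 ≠ (g ⟨e, h⟩).2.1.2 := (g ⟨e, h⟩).2.2.ne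
      obtain ⟨-, ⟨-, a2, a3⟩ | ⟨-, a2, a3⟩⟩ := hd2 e h <;> rw [a2, a3] at this <;>
        simp [Pi.single_apply, hne] at this
    · rw [hv3 e h] at h0
      have := congrFun h0 (g₃ ⟨e, h⟩).1.1
      simp only [Pi.add_apply, Pi.single_eq_same, Pi.zero_apply, Pi.single_apply] at this
      split_ifs at this <;> norm_num at this
  · have hsurj : ∀ t : E → ℝ, ∃ x : RigDom d n, ∀ e, rowVal d n tail head 1 c qm qp x e = t e := by
      intro t
      obtain ⟨p, hp⟩ := hk (fun e => t e)
      obtain ⟨S, hS⟩ := pb_S g₃ g₃.injective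
        (fun e => t e - (p (head e) - p (tail e)) ⬝ᵥ edgeVec d 1 c qm qp e)
      obtain ⟨B, hB⟩ := pb_B g hg
        (fun e => (if qm e.1 = 0 then (1 : ℝ) else -1) *
          (t e - (S.mulVec (fun r => (c e r : ℝ)) + p (head e) - p (tail e))
            ⬝ᵥ edgeVec d 1 c qm qp e))
      refine ⟨(p, B, S), fun e => ?_⟩
      rcases hmem e with h | h | h
      · obtain ⟨a1, a2, a3⟩ := hd1 e h
        have := hp ⟨e, h⟩
        simp only [rowVal, hv1 e h, a1, a2, a3, hcast0]
        simp only [Matrix.mulVec_zero, Matrix.mulVec_single_one, dotProduct_single, mul_one,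
          Pi.add_apply, Pi.sub_apply, Pi.zero_apply, Matrix.col_apply, Matrix.sub_apply,
          Matrix.transpose_apply]
        rw [← this]; ring
      · have hBe := hB ⟨e, h⟩
        have hve := hv2 e h
        obtain ⟨-, hcase⟩ := hd2 e h
        simp only [rowVal]
        rcases hcase with ⟨b1, b2, b3⟩ | ⟨b1, b2, b3⟩
        · simp only [b2, if_true, one_mul] at hBe
          rw [b1] at hBe
          rw [b2, Matrix.mulVec_zero]
          have hA : ((B (head e) - (B (head e))ᵀ).mulVec (qp e)) ⬝ᵥ edgeVec d 1 c qm qp e =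
              (B (head e) - (B (head e))ᵀ) (g ⟨e, h⟩).2.1.1 (g ⟨e, h⟩).2.1.2 := by
            rw [hve, b2, b3]
            simp [Matrix.mulVec_single_one, dotProduct_add, dotProduct_single]
          rw [hBe] at hA
          simp only [add_dotProduct, sub_dotProduct, zero_dotProduct] at hA ⊢
          linarith
        · have hq : qm e ≠ 0 := by
            rw [b3]; intro h0
            have := congrFun h0 (g ⟨e, h⟩).2.1.2
            simp at this
          simp only [hq, if_false] at hBe
          rw [b1] at hBe
          rw [b2, Matrix.mulVec_zero]
          have hA : ((B (tail e) - (B (tail e))ᵀ).mulVec (qm e)) ⬝ᵥ edgeVec d 1 c qm qp e =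
              (B (tail e) - (B (tail e))ᵀ) (g ⟨e, h⟩).2.1.1 (g ⟨e, h⟩).2.1.2 := by
            rw [hve, b2, b3]
            simp [Matrix.mulVec_single_one, dotProduct_sub, dotProduct_single]
          rw [hBe] at hA
          simp only [add_dotProduct, sub_dotProduct, zero_dotProduct] at hA ⊢
          linarith
      · obtain ⟨a1, a2, a3⟩ := hd3 e h
        have hSe := hS ⟨e, h⟩
        have hve := hv3 e h
        simp only [rowVal, a1, a2, a3, hcast2, Matrix.mulVec_zero]
        rw [← hve] at hSe ⊢
        simp only [add_dotProduct, sub_dotProduct, zero_dotProduct] at hSe ⊢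
        linarith
    unfold rigidityRank
    have htop : Submodule.span ℝ (Set.range fun x : RigDom d n =>
        fun e : (Finset.univ : Finset E) => rowVal d n tail head 1 c qm qp x e.1) = ⊤ := by
      rw [eq_top_iff]
      intro t _
      obtain ⟨x, hx⟩ := hsurj (fun e => t ⟨e, Finset.mem_univ e⟩)
      exact Submodule.subset_span ⟨x, funext fun e => hx e.1⟩
    rw [htop, finrank_top]
    simp
end

section
/- Let d ≥ 1 and let G be a multigraph on a finite vertex set V with |V| = n and edge set E with |E| = binom(d+1,2)(n−1) + d². Then the following are equivalent: (i) E decomposes as a disjoint union E = F₁ ⊔ F₂ where F₁ is (d,d)-tight and F₂ is (binom(d,2), binom(d+1,2))-tight; (ii) E contains two disjoint subsets F₁′ and F₂′ such that F₁′ is (d,d)-tight and F₂′ is (binom(d,2), 0)-tight. -/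
theorem choose_sq_aux (d : ℕ) : d ^ 2 = d.choose 2 + (d + 1).choose 2 := by
  induction d with
  | zero => simp
  | succ k ih =>
    have h1 : (k + 1).choose 2 = k + k.choose 2 := by
      rw [Nat.choose_succ_succ' k 1]; simp
    have h2 : (k + 1 + 1).choose 2 = (k + 1) + (k + 1).choose 2 := by
      rw [Nat.choose_succ_succ' (k + 1) 1]; simp
    nlinarith

/-- An `(a,c)`-tight edge set with `c ≥ 0` contains an `(a,0)`-tight subset (Hall). -/
theorem exists_tight_zero {V E : Type*} [Fintype V] [DecidableEq V] [DecidableEq E]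
    (tail head : E → V) (a c : ℕ) (F : Finset E) (hF : Tight tail head a (c : ℤ) F) :
    ∃ F' ⊆ F, Tight tail head a 0 F' := by
  obtain ⟨hs, hc⟩ := hF
  let t : V × Fin a → Finset E := fun p => F.filter fun e => tail e = p.1 ∨ head e = p.1
  have hall : ∀ s : Finset (V × Fin a), s.card ≤ (s.biUnion t).card := by
    intro s
    set W := s.image Prod.fst with hW
    have h1 : s.card ≤ W.card * a := by
      have : s ⊆ W ×ˢ (Finset.univ : Finset (Fin a)) := by
        intro p hp
        simp only [Finset.mem_product, Finset.mem_univ, and_true, hW]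
        exact Finset.mem_image_of_mem _ hp
      simpa using Finset.card_le_card this
    have h2 : F ⊆ s.biUnion t ∪ F.filter fun e => tail e ∈ Wᶜ ∧ head e ∈ Wᶜ := by
      intro e he
      by_cases h : tail e ∈ Wᶜ ∧ head e ∈ Wᶜ
      · exact Finset.mem_union_right _ (Finset.mem_filter.2 ⟨he, h⟩)
      · apply Finset.mem_union_left
        have h' : tail e ∈ W ∨ head e ∈ W := by
          simp only [Finset.mem_compl] at h
          tauto
        rw [Finset.mem_biUnion]
        rcases h' with h' | h' <;> obtain ⟨p, hp, hpe⟩ := Finset.mem_image.1 h'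
        · exact ⟨p, hp, Finset.mem_filter.2 ⟨he, Or.inl hpe.symm⟩⟩
        · exact ⟨p, hp, Finset.mem_filter.2 ⟨he, Or.inr hpe.symm⟩⟩
    have h3 := (Finset.card_le_card h2).trans (Finset.card_union_le _ _)
    have h4 : (((F.filter fun e => tail e ∈ Wᶜ ∧ head e ∈ Wᶜ).card : ℕ) : ℤ)
        ≤ a * (Wᶜ).card + c := by
      rcases (Wᶜ).eq_empty_or_nonempty with h | h
      · rw [h]; simp
      · exact hs _ h
    have h5 : W.card + (Wᶜ).card = Fintype.card V := Finset.card_add_card_compl W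
    zify at h1 h3 h5 ⊢
    rw [← h5] at hc
    nlinarith
  obtain ⟨f, hf, hft⟩ := (Finset.all_card_le_biUnion_card_iff_exists_injective t).1 hall
  refine ⟨Finset.univ.image f, ?_, ?_, ?_⟩
  · intro e he
    obtain ⟨p, -, rfl⟩ := Finset.mem_image.1 he
    exact (Finset.mem_filter.1 (hft p)).1
  · intro U _
    have : ((Finset.univ.image f).filter fun e => tail e ∈ U ∧ head e ∈ U)
        ⊆ (U ×ˢ (Finset.univ : Finset (Fin a))).image f := by
      intro e he
      obtain ⟨he, h1, h2⟩ := Finset.mem_filter.1 he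
      obtain ⟨p, -, rfl⟩ := Finset.mem_image.1 he
      refine Finset.mem_image_of_mem _ ?_
      simp only [Finset.mem_product, Finset.mem_univ, and_true]
      rcases (Finset.mem_filter.1 (hft p)).2 with h | h
      · rwa [← h]
      · rwa [← h]
    have h := (Finset.card_le_card this).trans Finset.card_image_le
    rw [Finset.card_product, Finset.card_univ, Fintype.card_fin] at h
    zify at h
    linarith
  · rw [Finset.card_image_of_injective _ hf]
    simp [mul_comm]

/-- the two forms of the combinatorial characterization agree.
For a multigraph with `|E| = C(d+1,2)(n−1) + d²` edges on `n` vertices, `E` decomposes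
as a disjoint union of a `(d,d)`-tight set (`|F₁| = dn − d`) and a
`(C(d,2), C(d+1,2))`-tight set, iff `E` contains two disjoint subsets, one `(d,d)`-tight
and one `(C(d,2), 0)`-tight. -/
theorem stmt_10 {d : ℕ} (hd : 1 ≤ d) {V E : Type*} [Fintype V] [DecidableEq V]
    [Fintype E] [DecidableEq E] (tail head : E → V)
    (hE : Fintype.card E + (d + 1).choose 2 = (d + 1).choose 2 * Fintype.card V + d ^ 2) :
    (∃ F₁ F₂ : Finset E, Disjoint F₁ F₂ ∧ F₁ ∪ F₂ = Finset.univ ∧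
        Tight tail head d (-(d : ℤ)) F₁ ∧
        Tight tail head (d.choose 2) ((d + 1).choose 2 : ℤ) F₂)
      ↔ ∃ F₁' F₂' : Finset E, Disjoint F₁' F₂' ∧
          Tight tail head d (-(d : ℤ)) F₁' ∧
          Tight tail head (d.choose 2) 0 F₂' := by
  constructor
  · rintro ⟨F₁, F₂, hdis, -, h1, h2⟩
    obtain ⟨F', hF', h⟩ := exists_tight_zero tail head _ _ F₂ h2
    exact ⟨F₁, F', Finset.disjoint_of_subset_right hF' hdis, h1, h⟩
  · rintro ⟨F₁, F₂, hdis, h1, h2⟩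
    have hch : (d + 1).choose 2 = d + d.choose 2 := by
      rw [Nat.choose_succ_succ' d 1]; simp
    have hsq := choose_sq_aux d
    have hsub : F₂ ⊆ F₁ᶜ := by
      intro e he
      rw [Finset.mem_compl]
      exact fun h => (Finset.disjoint_left.1 hdis h) he
    have hcard : ((F₁ᶜ).card : ℤ)
        = (d.choose 2 : ℕ) * Fintype.card V + ((d + 1).choose 2 : ℕ) := by
      have h3 : F₁.card + (F₁ᶜ).card = Fintype.card E := Finset.card_add_card_compl F₁
      have h4 := h1.2
      rw [hsq] at hE
      zify at h3 hE hch
      rw [hch] at hE ⊢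
      linarith
    refine ⟨F₁, F₁ᶜ, disjoint_compl_right, Finset.union_compl F₁, h1, ?_, hcard⟩
    intro U hU
    have h5 : ((F₁ᶜ).filter fun e => tail e ∈ U ∧ head e ∈ U) ⊆
        (F₂.filter fun e => tail e ∈ U ∧ head e ∈ U) ∪ (F₁ᶜ \ F₂) := by
      intro e he
      obtain ⟨he, h⟩ := Finset.mem_filter.1 he
      by_cases h2 : e ∈ F₂
      · exact Finset.mem_union_left _ (Finset.mem_filter.2 ⟨h2, h⟩)
      · exact Finset.mem_union_right _ (Finset.mem_sdiff.2 ⟨he, h2⟩)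
    have h6 := (Finset.card_le_card h5).trans (Finset.card_union_le _ _)
    have h7 := Finset.card_sdiff_add_card_eq_card hsub
    have h8 := h2.1 U hU
    have h9 := h2.2
    zify at h6 h7
    linarith
end

section
/- Let d ≥ 1, let G be a multigraph on vertex set V = {1,…,n} with edge set E, and let each vertex v carry a weight k_v ∈ {0,…,d}, with k_v′ = d·k_v − binom(k_v+1, 2). Assume |E| = d(n−1) + Σ_{v∈V} k_v′ + binom(d+1,2). Then there exists a mixed presentation of G whose mixed rigidity matrix has rank |E| if and only if for every nonempty subset F ⊆ E one has |F| ≤ d(n_F − ω_F) + Σ_{v ∈ V_F} k_v′ + binom(d+1,2). (Maxwell–Laman characterization for mixed plate-and-bar periodic frameworks.) -/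
open Matrix

/-- The restricted skew-symmetric rotation unknown of a vertex of weight `k`: as `B`
ranges over all matrices, `restrictedSkew d k B` ranges over all skew-symmetric `d × d`
matrices whose `(r,s)` entry vanishes whenever both `r` and `s` exceed `k` (in 1-based
indexing), i.e. over a space of dimension `d·k − C(k+1,2)`. -/
noncomputable def restrictedSkew (d k : ℕ) (B : Matrix (Fin d) (Fin d) ℝ) :
    Matrix (Fin d) (Fin d) ℝ :=
  Matrix.of fun r s => if k ≤ (r : ℕ) ∧ k ≤ (s : ℕ) then 0 else B r s - B s r

/-- The value of the row of the mixed rigidity matrix indexed by the edge `e`, evaluated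
at the vector of unknowns `x`:
`⟨Λ̇ c(e) + A_{head e} q⁺(e) − A_{tail e} q⁻(e) + ṗ_{head e} − ṗ_{tail e}, h(e)⟩`. -/
noncomputable def mixedRowVal {E : Type*} (d n : ℕ) (k : Fin n → ℕ)
    (tail head : E → Fin n)
    (Λ : Matrix (Fin d) (Fin d) ℝ) (c : E → Fin d → ℤ) (qm qp : E → Fin d → ℝ)
    (x : RigDom d n) (e : E) : ℝ :=
  (x.2.2.mulVec (fun r => (c e r : ℝ))
      + (restrictedSkew d (k (head e)) (x.2.1 (head e))).mulVec (qp e)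
      - (restrictedSkew d (k (tail e)) (x.2.1 (tail e))).mulVec (qm e)
      + x.1 (head e) - x.1 (tail e))
    ⬝ᵥ edgeVec d Λ c qm qp e

/-- The rank of the submatrix of the mixed rigidity matrix formed by the rows indexed
by `F`. -/
noncomputable def mixedRigidityRank {E : Type*} (d n : ℕ) (k : Fin n → ℕ)
    (tail head : E → Fin n)
    (Λ : Matrix (Fin d) (Fin d) ℝ) (c : E → Fin d → ℤ) (qm qp : E → Fin d → ℝ)
    (F : Finset E) : ℕ :=
  Module.finrank ℝ (Submodule.span ℝ
    (Set.range fun x : RigDom d n =>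
      fun e : F => mixedRowVal d n k tail head Λ c qm qp x e.1))

/-- A mixed presentation: the last `d − k_v` coordinates of the attachment of each bar end
on a plate of weight `k_v` vanish. -/
def IsMixedAttachment {E : Type*} (d n : ℕ) (k : Fin n → ℕ) (tail head : E → Fin n)
    (qm qp : E → Fin d → ℝ) : Prop :=
  ∀ e, ∀ r : Fin d,
    (k (tail e) ≤ (r : ℕ) → qm e r = 0) ∧ (k (head e) ≤ (r : ℕ) → qp e r = 0)

theorem rado_fin {K M E : Type*} [Field K] [AddCommGroup M] [Module K M] [FiniteDimensional K M]
    [Fintype E] [DecidableEq E] [DecidableEq M] (m : ℕ) : ∀ (A : E → Finset M), (∑ e, (A e).card = m) →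
    (∀ F : Finset E, F.card ≤ Module.finrank K (⨆ e ∈ F, Submodule.span K (A e : Set M) : Submodule K M)) →
    ∃ x : E → M, (∀ e, x e ∈ A e) ∧ LinearIndependent K x := by
  induction m using Nat.strong_induction_on with
  | _ m ih =>
  intro A hm hA
  have hne : ∀ e, (A e).Nonempty := by
    intro e
    by_contra h
    rw [Finset.not_nonempty_iff_eq_empty] at h
    have := hA {e}
    simp [h] at this
  by_cases hbig : ∃ e, ∃ x ∈ A e, ∃ y ∈ A e, x ≠ y
  · obtain ⟨e, x, hx, y, hy, hxy⟩ := hbig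
    have key : ∀ z ∈ A e, (∃ x : E → M, (∀ e, x e ∈ A e) ∧ LinearIndependent K x) ∨
        ∃ F : Finset E, e ∉ F ∧ Module.finrank K ((⨆ e ∈ F, Submodule.span K (A e : Set M)) ⊔
          Submodule.span K ((A e).erase z : Set M) : Submodule K M) ≤ F.card := by
      intro z hz
      by_cases h : ∀ F : Finset E, F.card ≤ Module.finrank K
          (⨆ e' ∈ F, Submodule.span K (Function.update A e ((A e).erase z) e' : Set M) : Submodule K M)
      · left
        have hlt : ∑ e', (Function.update A e ((A e).erase z) e').card < m := by
          rw [← hm]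
          apply Finset.sum_lt_sum
          · intro e' _
            by_cases he : e' = e
            · subst he
              rw [Function.update_self]
              exact Finset.card_le_card (Finset.erase_subset _ _)
            · rw [Function.update_of_ne he]
          · refine ⟨e, Finset.mem_univ _, ?_⟩
            rw [Function.update_self]
            exact Finset.card_erase_lt_of_mem hz
        obtain ⟨x, hx, hl⟩ := ih _ hlt (Function.update A e ((A e).erase z)) rfl h
        · refine ⟨x, fun e' => ?_, hl⟩
          have := hx e'
          by_cases he : e' = e
          · subst he
            rw [Function.update_self] at this
            exact Finset.mem_of_mem_erase this
          · rwa [Function.update_of_ne he] at this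
      · right
        push Not at h
        obtain ⟨F, hF⟩ := h
        have hcongr : ∀ F' : Finset E, e ∉ F' →
            (⨆ e' ∈ F', Submodule.span K (Function.update A e ((A e).erase z) e' : Set M) : Submodule K M)
            = ⨆ e' ∈ F', Submodule.span K (A e' : Set M) := by
          intro F' hF'
          refine iSup_congr fun e' => iSup_congr fun h' => ?_
          rw [Function.update_of_ne]
          rintro rfl
          exact hF' h'
        by_cases he : e ∈ F
        · refine ⟨F.erase e, by simp, ?_⟩
          have h1 : F = insert e (F.erase e) := (Finset.insert_erase he).symm
          rw [h1, Finset.iSup_insert, hcongr _ (by simp), Function.update_self,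
            Finset.card_insert_of_notMem (by simp), sup_comm] at hF
          omega
        · rw [hcongr F he] at hF
          have := hA F
          omega
    rcases key x hx with h | ⟨F1, he1, h1⟩
    · exact h
    rcases key y hy with h | ⟨F2, he2, h2⟩
    · exact h
    exfalso
    have hsub := Submodule.finrank_sup_add_finrank_inf_eq
      ((⨆ e ∈ F1, Submodule.span K (A e : Set M)) ⊔ Submodule.span K ((A e).erase x : Set M))
      ((⨆ e ∈ F2, Submodule.span K (A e : Set M)) ⊔ Submodule.span K ((A e).erase y : Set M))
    have hU := (hA (insert e (F1 ∪ F2))).trans (Submodule.finrank_mono (t := 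
      ((⨆ e ∈ F1, Submodule.span K (A e : Set M)) ⊔ Submodule.span K ((A e).erase x : Set M)) ⊔
      ((⨆ e ∈ F2, Submodule.span K (A e : Set M)) ⊔ Submodule.span K ((A e).erase y : Set M))) (by
        rw [Finset.iSup_insert, Finset.iSup_union]
        refine sup_le ?_ (sup_le ?_ ?_)
        · rw [Submodule.span_le]
          intro z hz
          by_cases hzx : z = x
          · refine le_sup_right (a := (⨆ e ∈ F1, Submodule.span K (A e : Set M)) ⊔ Submodule.span K ((A e).erase x : Set M)) (le_sup_right (a := (⨆ e ∈ F2, Submodule.span K (A e : Set M))) (Submodule.subset_span ?_))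
            simp only [Finset.coe_erase]
            refine ⟨hz, ?_⟩
            simp only [Set.mem_singleton_iff]
            rw [hzx]; exact hxy
          · refine le_sup_left (b := (⨆ e ∈ F2, Submodule.span K (A e : Set M)) ⊔ Submodule.span K ((A e).erase y : Set M)) (le_sup_right (a := (⨆ e ∈ F1, Submodule.span K (A e : Set M))) (Submodule.subset_span ?_))
            simp only [Finset.coe_erase]
            exact ⟨hz, hzx⟩
        · exact le_sup_left.trans le_sup_left
        · exact le_sup_left.trans le_sup_right))
    have hI := (hA (F1 ∩ F2)).trans (Submodule.finrank_mono (t := 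
      ((⨆ e ∈ F1, Submodule.span K (A e : Set M)) ⊔ Submodule.span K ((A e).erase x : Set M)) ⊓
      ((⨆ e ∈ F2, Submodule.span K (A e : Set M)) ⊔ Submodule.span K ((A e).erase y : Set M))) (by
        refine le_inf (le_trans ?_ le_sup_left) (le_trans ?_ le_sup_left)
        · exact biSup_mono fun i hi => Finset.mem_of_mem_inter_left hi
        · exact biSup_mono fun i hi => Finset.mem_of_mem_inter_right hi))
    have hc := Finset.card_union_add_card_inter F1 F2
    rw [Finset.card_insert_of_notMem (by simp [he1, he2])] at hU
    omega
  · push Not at hbig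
    choose x hx using hne
    refine ⟨x, hx, ?_⟩
    rw [linearIndependent_iff_card_le_finrank_span]
    have h1 := hA Finset.univ
    rw [Finset.card_univ] at h1
    refine h1.trans (Submodule.finrank_mono ?_)
    refine iSup_le fun e => iSup_le fun _ => ?_
    rw [Submodule.span_le]
    intro z hz
    rw [hbig e z hz (x e) (hx e)]
    exact Submodule.subset_span ⟨e, rfl⟩

theorem rado_set {K M E : Type*} [Field K] [AddCommGroup M] [Module K M] [FiniteDimensional K M]
    [Fintype E] [DecidableEq E] (X : E → Set M)
    (hX : ∀ F : Finset E, F.card ≤ Module.finrank K (⨆ e ∈ F, Submodule.span K (X e) : Submodule K M)) :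
    ∃ x : E → M, (∀ e, x e ∈ X e) ∧ LinearIndependent K x := by
  classical
  have h : ∀ e, ∃ A : Finset M, (A : Set M) ⊆ X e ∧ Submodule.span K (A : Set M) = Submodule.span K (X e) := by
    intro e
    obtain ⟨t, ht, hs, hli⟩ := exists_linearIndependent K (X e)
    have hf : t.Finite := hli.setFinite
    exact ⟨hf.toFinset, by simpa using ht, by simpa using hs⟩
  choose A hA hs using h
  obtain ⟨x, hx, hl⟩ := rado_fin (K := K) _ A rfl (by
    intro F
    have := hX F
    have h2 : (⨆ e ∈ F, Submodule.span K (X e) : Submodule K M)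
        = ⨆ e ∈ F, Submodule.span K (A e : Set M) := by simp_rw [hs]
    rwa [h2] at this)
  exact ⟨x, fun e => hA e (hx e), hl⟩

/-- `restrictedSkew` as a linear map. -/
noncomputable def rsLin (d k : ℕ) : Matrix (Fin d) (Fin d) ℝ →ₗ[ℝ] Matrix (Fin d) (Fin d) ℝ where
  toFun := restrictedSkew d k
  map_add' A B := by
    ext r s
    simp only [restrictedSkew, Matrix.of_apply, Matrix.add_apply]
    split_ifs <;> ring
  map_smul' a A := by
    ext r s
    simp only [restrictedSkew, Matrix.of_apply, Matrix.smul_apply, smul_eq_mul, RingHom.id_apply]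
    split_ifs <;> ring

theorem sum_aux (d k : ℕ) (hk : k ≤ d) :
    (∑ r ∈ Finset.range k, (d - 1 - r)) + (k + 1).choose 2 = d * k := by
  induction k with
  | zero => simp
  | succ k ih =>
    have := ih (by omega)
    rw [Finset.sum_range_succ, Nat.choose_succ_succ' (k + 1) 1, Nat.choose_one_right]
    have h2 : d * (k + 1) = d * k + d := by ring
    simp only [Nat.reduceAdd] at *
    omega

theorem card_aux (d k : ℕ) (hk : k ≤ d) :
    Fintype.card {t : Fin d × Fin d // t.1 < t.2 ∧ (t.1 : ℕ) < k} = d * k - (k + 1).choose 2 := by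
  have h1 : Fintype.card {t : Fin d × Fin d // t.1 < t.2 ∧ (t.1 : ℕ) < k}
      = ∑ r ∈ Finset.range k, (d - 1 - r) := by
    rw [Fintype.card_subtype, Finset.card_filter, Fintype.sum_prod_type]
    have : ∀ r : Fin d, (∑ s : Fin d, if r < s ∧ (r : ℕ) < k then 1 else 0)
        = if (r : ℕ) < k then d - 1 - (r : ℕ) else 0 := by
      intro r
      split_ifs with h
      · simp only [h, and_true]
        rw [← Finset.card_filter]
        have := Fin.card_Ioi r
        rw [← this]
        congr 1
        ext s; simp
      · simp [h]
    simp only [this]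
    rw [Fin.sum_univ_eq_sum_range (fun r => if r < k then d - 1 - r else 0) d]
    rw [← Finset.sum_filter]
    congr 1
    ext r; simp; omega
  have := sum_aux d k hk
  omega

theorem finrank_ker_rsLin (d k : ℕ) (hk : k ≤ d) :
    Module.finrank ℝ (LinearMap.ker (rsLin d k)) + (d * k - (k + 1).choose 2) = d * d := by
  let T := {t : Fin d × Fin d // t.1 < t.2 ∧ (t.1 : ℕ) < k}
  let ρ : Matrix (Fin d) (Fin d) ℝ →ₗ[ℝ] (T → ℝ) :=
    { toFun := fun B t => restrictedSkew d k B t.1.1 t.1.2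
      map_add' := fun A B => by
        funext t
        exact congrFun (congrFun ((rsLin d k).map_add A B) t.1.1) t.1.2
      map_smul' := fun a B => by
        funext t
        exact congrFun (congrFun ((rsLin d k).map_smul a B) t.1.1) t.1.2 }
  have hker : LinearMap.ker ρ = LinearMap.ker (rsLin d k) := by
    ext B
    simp only [LinearMap.mem_ker]
    constructor
    · intro h
      have h' : ∀ t : T, restrictedSkew d k B t.1.1 t.1.2 = 0 := fun t => congrFun h t
      ext r s
      change restrictedSkew d k B r s = 0
      by_cases hrs : k ≤ (r : ℕ) ∧ k ≤ (s : ℕ)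
      · simp [restrictedSkew, hrs]
      · rcases lt_trichotomy r s with hlt | heq | hgt
        · exact h' ⟨(r, s), hlt, by
            have : (r : ℕ) < s := hlt
            simp only; omega⟩
        · subst heq; simp [restrictedSkew]
        · have := h' ⟨(s, r), hgt, by
            have : (s : ℕ) < r := hgt
            simp only; omega⟩
          have hsr : ¬ (k ≤ (s : ℕ) ∧ k ≤ (r : ℕ)) := by omega
          simp only [restrictedSkew, Matrix.of_apply, if_neg hrs, if_neg hsr] at this ⊢
          linarith
    · intro h
      funext t
      exact congrFun (congrFun h t.1.1) t.1.2
  have hsurj : Function.Surjective ρ := by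
    intro f
    refine ⟨Matrix.of fun r s => if h : r < s ∧ (r : ℕ) < k then f ⟨(r, s), h⟩ else 0, ?_⟩
    funext t
    obtain ⟨⟨r, s⟩, h1, h2⟩ := t
    change restrictedSkew d k _ r s = _
    have hrs : ¬ (k ≤ (r : ℕ) ∧ k ≤ (s : ℕ)) := by simp only at h2; omega
    have h3 : ¬ (s < r) := not_lt.mpr (le_of_lt h1)
    simp only at h1 h2
    simp only [restrictedSkew, Matrix.of_apply, if_neg hrs, h1, h2, h3, false_and, dif_neg, and_self,
      dif_pos, not_false_eq_true, sub_zero]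
  have hrn := LinearMap.finrank_range_add_finrank_ker ρ
  rw [LinearMap.range_eq_top.mpr hsurj, finrank_top, hker] at hrn
  rw [Module.finrank_matrix, Module.finrank_fintype_fun_eq_card, card_aux d k hk] at hrn
  simp at hrn
  omega

/-- Skew-symmetric matrices. -/
def skewSub (d : ℕ) : Submodule ℝ (Matrix (Fin d) (Fin d) ℝ) where
  carrier := {R | ∀ r s, R r s + R s r = 0}
  zero_mem' := by intro r s; simp
  add_mem' := by
    intro A B hA hB r s
    have := hA r s
    have := hB r s
    simp only [Matrix.add_apply]; linarith
  smul_mem' := by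
    intro a A hA r s
    simp only [Matrix.smul_apply, smul_eq_mul, ← mul_add]
    rw [hA r s, mul_zero]

theorem finrank_skewSub (d : ℕ) :
    Module.finrank ℝ (skewSub d) + (d + 1).choose 2 = d * d := by
  have h : skewSub d = LinearMap.range (rsLin d d) := by
    ext R
    constructor
    · intro hR
      refine ⟨(1 / 2 : ℝ) • R, ?_⟩
      ext r s
      change restrictedSkew d d _ r s = _
      have hr : ¬ (d ≤ (r : ℕ) ∧ d ≤ (s : ℕ)) := by omega
      have := hR r s
      simp only [restrictedSkew, Matrix.of_apply, if_neg hr, Matrix.smul_apply, smul_eq_mul]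
      linarith
    · rintro ⟨B, rfl⟩ r s
      change restrictedSkew d d B r s + restrictedSkew d d B s r = 0
      have hr : ¬ (d ≤ (r : ℕ) ∧ d ≤ (s : ℕ)) := by omega
      have hs : ¬ (d ≤ (s : ℕ) ∧ d ≤ (r : ℕ)) := by omega
      simp only [restrictedSkew, Matrix.of_apply, if_neg hr, if_neg hs]
      ring
  have h1 := finrank_ker_rsLin d d le_rfl
  have hrn := LinearMap.finrank_range_add_finrank_ker (rsLin d d)
  rw [← h, Module.finrank_matrix] at hrn
  simp at hrn
  have := sum_aux d d le_rfl
  omega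

/-- Translations constant along the edges of `F`. -/
def transSub {E : Type*} (d n : ℕ) (tail head : E → Fin n) (F : Finset E) :
    Submodule ℝ (Fin n → Fin d → ℝ) where
  carrier := {p | ∀ e ∈ F, p (head e) = p (tail e)}
  zero_mem' := by intro e _; rfl
  add_mem' := by
    intro a b ha hb e he
    simp only [Pi.add_apply, ha e he, hb e he]
  smul_mem' := by
    intro a b hb e he
    simp only [Pi.smul_apply, hb e he]

theorem finrank_transSub {E : Type*} (d n : ℕ) (tail head : E → Fin n) (F : Finset E) :
    Module.finrank ℝ (transSub d n tail head F) + d * (incVerts tail head F).card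
      = d * n + d * numComp tail head F := by
  classical
  let V := incVerts tail head F
  have hVt : ∀ e ∈ F, tail e ∈ V := fun e he =>
    Finset.mem_union_left _ (Finset.mem_image_of_mem _ he)
  have hVh : ∀ e ∈ F, head e ∈ V := fun e he =>
    Finset.mem_union_right _ (Finset.mem_image_of_mem _ he)
  let Q := Quot fun u v : {x : Fin n // x ∈ V} => adjRel tail head F u.1 v.1
  have : Finite Q := Quot.finite _
  have : Fintype Q := Fintype.ofFinite Q
  let π : Fin n → Q ⊕ {x : Fin n // x ∉ V} := fun v =>
    if h : v ∈ V then Sum.inl (Quot.mk _ ⟨v, h⟩) else Sum.inr ⟨v, h⟩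
  have hπV : ∀ v (h : v ∈ V), π v = Sum.inl (Quot.mk _ ⟨v, h⟩) := fun v h => dif_pos h
  have hπN : ∀ v (h : v ∉ V), π v = Sum.inr ⟨v, h⟩ := fun v h => dif_neg h
  have hπ : Function.Surjective π := by
    rintro (q | ⟨v, hv⟩)
    · induction q using Quot.ind with
      | mk v => exact ⟨v.1, hπV v.1 v.2⟩
    · exact ⟨v, hπN v hv⟩
  let L : ((Q ⊕ {x : Fin n // x ∉ V}) → (Fin d → ℝ)) →ₗ[ℝ] (Fin n → Fin d → ℝ) :=
    LinearMap.funLeft ℝ (Fin d → ℝ) π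
  have hL : Function.Injective L := LinearMap.funLeft_injective_of_surjective _ _ _ hπ
  have hr : LinearMap.range L = transSub d n tail head F := by
    ext p
    constructor
    · rintro ⟨f, rfl⟩ e he
      change f (π (head e)) = f (π (tail e))
      congr 1
      rw [hπV _ (hVh e he), hπV _ (hVt e he)]
      congr 1
      exact Quot.sound ⟨e, he, Or.inr ⟨rfl, rfl⟩⟩
    · intro hp
      refine ⟨Sum.elim (Quot.lift (fun v => p v.1) ?_) (fun v => p v.1), ?_⟩
      · rintro a b ⟨e, he, ⟨h1, h2⟩ | ⟨h1, h2⟩⟩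
        · rw [← h1, ← h2]; exact (hp e he).symm
        · rw [← h1, ← h2]; exact hp e he
      · funext v
        change Sum.elim _ _ (π v) = _
        by_cases h : v ∈ V
        · rw [hπV v h]; rfl
        · rw [hπN v h]; rfl
  rw [← hr, LinearMap.finrank_range_of_inj hL, Module.finrank_pi_fintype]
  simp only [Module.finrank_fintype_fun_eq_card, Fintype.card_fin, Finset.sum_const, smul_eq_mul,
    Finset.card_univ, Fintype.card_sum]
  have hQ : Fintype.card Q = numComp tail head F := by
    rw [← Nat.card_eq_fintype_card]; rfl
  have hc : Fintype.card {x : Fin n // x ∉ V} + V.card = n := by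
    have := Fintype.card_subtype_compl (fun x => x ∈ V)
    have h2 : V.card ≤ n := by simpa using Finset.card_le_univ V
    rw [this]
    simp
    omega
  change _ + d * V.card = _
  rw [hQ]
  nlinarith [hc]

/-- Rotations that vanish (after restriction) on the vertices of `V`. -/
noncomputable def rotSub (d n : ℕ) (k : Fin n → ℕ) (V : Finset (Fin n)) :
    Submodule ℝ (Fin n → Matrix (Fin d) (Fin d) ℝ) :=
  Submodule.pi Set.univ (fun v => if v ∈ V then LinearMap.ker (rsLin d (k v)) else ⊤)

theorem finrank_rotSub (d n : ℕ) (k : Fin n → ℕ) (hk : ∀ v, k v ≤ d) (V : Finset (Fin n)) :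
    Module.finrank ℝ (rotSub d n k V) + ∑ v ∈ V, (d * k v - (k v + 1).choose 2)
      = n * (d * d) := by
  let S : Fin n → Submodule ℝ (Matrix (Fin d) (Fin d) ℝ) :=
    fun v => if v ∈ V then LinearMap.ker (rsLin d (k v)) else ⊤
  let eqv : rotSub d n k V ≃ₗ[ℝ] (∀ v, S v) :=
    { toFun := fun x v => ⟨x.1 v, x.2 v trivial⟩
      invFun := fun y => ⟨fun v => (y v).1, fun v _ => (y v).2⟩
      map_add' := fun _ _ => rfl
      map_smul' := fun _ _ => rfl
      left_inv := fun _ => rfl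
      right_inv := fun _ => rfl }
  rw [eqv.finrank_eq, Module.finrank_pi_fintype, ← Finset.sum_filter_add_sum_filter_not Finset.univ (fun v => v ∈ V)]
  have h0 : Finset.univ.filter (fun v => v ∈ V) = V := by ext; simp
  have h1 : ∑ v ∈ Finset.univ.filter (fun v => v ∉ V), Module.finrank ℝ (S v)
      = ∑ v ∈ Finset.univ.filter (fun v => v ∉ V), d * d := by
    refine Finset.sum_congr rfl fun v hv => ?_
    have : v ∉ V := by simpa using hv
    have hS : S v = ⊤ := if_neg this
    rw [hS, finrank_top, Module.finrank_matrix]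
    simp
  have h2 : ∑ v ∈ V, Module.finrank ℝ (S v) + ∑ v ∈ V, (d * k v - (k v + 1).choose 2)
      = ∑ v ∈ V, d * d := by
    rw [← Finset.sum_add_distrib]
    refine Finset.sum_congr rfl fun v hv => ?_
    have hS : S v = LinearMap.ker (rsLin d (k v)) := if_pos hv
    rw [hS, finrank_ker_rsLin d (k v) (hk v)]
  have h3 := Finset.sum_filter_add_sum_filter_not Finset.univ (fun v => v ∈ V) (fun _ : Fin n => d * d)
  rw [h0] at h3 ⊢
  rw [h1]
  simp only [Finset.sum_const, Finset.card_univ, Fintype.card_fin, smul_eq_mul] at h3 h2 ⊢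
  omega

/-- The (normalized) space of trivial motions of the edges of `F`. -/
noncomputable def trivSub {E : Type*} (d n : ℕ) (k : Fin n → ℕ) (tail head : E → Fin n) (F : Finset E) :
    Submodule ℝ (RigDom d n) :=
  (transSub d n tail head F).prod ((rotSub d n k (incVerts tail head F)).prod (skewSub d))

theorem finrank_sub_prod {A B : Type*} [AddCommGroup A] [AddCommGroup B] [Module ℝ A] [Module ℝ B]
    [FiniteDimensional ℝ A] [FiniteDimensional ℝ B] (S : Submodule ℝ A) (T : Submodule ℝ B) :
    Module.finrank ℝ (S.prod T) = Module.finrank ℝ S + Module.finrank ℝ T := by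
  let eqv : S.prod T ≃ₗ[ℝ] S × T :=
    { toFun := fun x => (⟨x.1.1, x.2.1⟩, ⟨x.1.2, x.2.2⟩)
      invFun := fun y => ⟨(y.1.1, y.2.1), y.1.2, y.2.2⟩
      map_add' := fun _ _ => rfl
      map_smul' := fun _ _ => rfl
      left_inv := fun _ => rfl
      right_inv := fun _ => rfl }
  rw [eqv.finrank_eq, Module.finrank_prod]

theorem finrank_trivSub {E : Type*} (d n : ℕ) (k : Fin n → ℕ) (hk : ∀ v, k v ≤ d)
    (tail head : E → Fin n) (F : Finset E) :
    Module.finrank ℝ (trivSub d n k tail head F) + (d * (incVerts tail head F).card +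
      ∑ v ∈ incVerts tail head F, (d * k v - (k v + 1).choose 2) + (d + 1).choose 2)
      = Module.finrank ℝ (RigDom d n) + d * numComp tail head F := by
  have h1 := finrank_transSub d n tail head F
  have h2 := finrank_rotSub d n k hk (incVerts tail head F)
  have h3 := finrank_skewSub d
  have h4 : Module.finrank ℝ (RigDom d n) = d * n + (n * (d * d) + d * d) := by
    have h5 : Module.finrank ℝ (Fin n → Matrix (Fin d) (Fin d) ℝ) = n * (d * d) := by
      rw [Module.finrank_pi_fintype]
      simp [Module.finrank_matrix]
    rw [Module.finrank_prod, Module.finrank_prod, h5, Module.finrank_pi_fintype,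
      Module.finrank_matrix]
    simp [mul_comm]
  rw [trivSub, finrank_sub_prod, finrank_sub_prod, h4]
  omega

/-- The row of the rigidity matrix of a single edge, as a linear functional. -/
noncomputable def rowLin (d n : ℕ) (k : Fin n → ℕ) (i j : Fin n) (Λ : Matrix (Fin d) (Fin d) ℝ)
    (c : Fin d → ℤ) (qm qp : Fin d → ℝ) : Module.Dual ℝ (RigDom d n) where
  toFun x := mixedRowVal (E := Unit) d n k (fun _ => i) (fun _ => j) Λ (fun _ => c)
    (fun _ => qm) (fun _ => qp) x ()
  map_add' x y := by
    have h1 : ∀ v, restrictedSkew d (k v) ((x + y).2.1 v)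
        = restrictedSkew d (k v) (x.2.1 v) + restrictedSkew d (k v) (y.2.1 v) :=
      fun v => (rsLin d (k v)).map_add _ _
    simp only [mixedRowVal]
    rw [h1, h1, ← add_dotProduct]
    congr 1
    simp only [Prod.snd_add, Prod.fst_add, Matrix.add_mulVec, Pi.add_apply]
    abel
  map_smul' a x := by
    have h1 : ∀ v, restrictedSkew d (k v) ((a • x).2.1 v)
        = a • restrictedSkew d (k v) (x.2.1 v) :=
      fun v => (rsLin d (k v)).map_smul _ _
    simp only [mixedRowVal, RingHom.id_apply]
    rw [h1, h1, ← smul_dotProduct]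
    congr 1
    simp only [Prod.smul_snd, Prod.smul_fst, Matrix.smul_mulVec, Pi.smul_apply, smul_sub, smul_add]

theorem rowLin_apply (d n : ℕ) (k : Fin n → ℕ) (i j : Fin n) (Λ : Matrix (Fin d) (Fin d) ℝ)
    (c : Fin d → ℤ) (qm qp : Fin d → ℝ) (x : RigDom d n) :
    rowLin d n k i j Λ c qm qp x =
      (x.2.2.mulVec (fun r => (c r : ℝ)) + (restrictedSkew d (k j) (x.2.1 j)).mulVec qp
      - (restrictedSkew d (k i) (x.2.1 i)).mulVec qm + x.1 j - x.1 i)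
      ⬝ᵥ (Λ.mulVec (fun r => (c r : ℝ)) + qp - qm) := rfl

/-- Trivial motions, unnormalized. -/
noncomputable def motLin (d n : ℕ) (Λ : Matrix (Fin d) (Fin d) ℝ) :
    RigDom d n →ₗ[ℝ] RigDom d n where
  toFun x := (x.1, fun v => x.2.1 v + (1 / 2 : ℝ) • x.2.2, x.2.2 * Λ)
  map_add' x y := by
    refine Prod.ext rfl (Prod.ext ?_ ?_)
    · funext v
      simp only [Prod.snd_add, Prod.fst_add, Pi.add_apply, smul_add]
      abel
    · simp only [Prod.snd_add, Matrix.add_mul]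
  map_smul' a x := by
    refine Prod.ext rfl (Prod.ext ?_ ?_)
    · funext v
      simp only [Prod.smul_snd, Prod.smul_fst, Pi.smul_apply, smul_add, RingHom.id_apply]
      rw [smul_comm]
    · simp only [Prod.smul_snd, Matrix.smul_mul, RingHom.id_apply]

theorem motLin_injective (d n : ℕ) (Λ : Matrix (Fin d) (Fin d) ℝ) (hΛ : IsUnit Λ) :
    Function.Injective (motLin d n Λ) := by
  intro x y h
  have h1 : (motLin d n Λ x).1 = (motLin d n Λ y).1 := congrArg (fun z : RigDom d n => z.1) h
  change x.1 = y.1 at h1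
  have h3 : x.2.2 * Λ = y.2.2 * Λ := congrArg (fun z : RigDom d n => z.2.2) h
  have h3' : x.2.2 = y.2.2 := hΛ.mul_right_cancel h3
  have h2 : (fun v => x.2.1 v + (1 / 2 : ℝ) • x.2.2) = fun v => y.2.1 v + (1 / 2 : ℝ) • y.2.2 :=
    congrArg (fun z : RigDom d n => z.2.1) h
  refine Prod.ext h1 (Prod.ext ?_ h3')
  funext v
  have : x.2.1 v + (1 / 2 : ℝ) • x.2.2 = y.2.1 v + (1 / 2 : ℝ) • y.2.2 := congrFun h2 v
  rw [h3'] at this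
  exact add_right_cancel this

theorem mem_rotSub {d n : ℕ} {k : Fin n → ℕ} {V : Finset (Fin n)}
    {B : Fin n → Matrix (Fin d) (Fin d) ℝ} :
    B ∈ rotSub d n k V ↔ ∀ v ∈ V, restrictedSkew d (k v) (B v) = 0 := by
  constructor
  · intro h v hv
    have := h v trivial
    simp only [if_pos hv] at this
    exact this
  · intro h v _
    simp only
    split_ifs with hv
    · exact h v hv
    · trivial

theorem rs_mulVec {d k : ℕ} {B R : Matrix (Fin d) (Fin d) ℝ} (hB : restrictedSkew d k B = 0)
    (hR : R ∈ skewSub d) {q : Fin d → ℝ} (hq : ∀ r : Fin d, k ≤ (r : ℕ) → q r = 0) :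
    (restrictedSkew d k (B + (1 / 2 : ℝ) • R)).mulVec q = R.mulVec q := by
  funext r
  simp only [Matrix.mulVec, dotProduct]
  refine Finset.sum_congr rfl fun s _ => ?_
  by_cases hs : k ≤ (s : ℕ)
  · rw [hq s hs, mul_zero, mul_zero]
  · congr 1
    have h1 := congrFun (congrFun hB r) s
    have h2 := hR r s
    have hn : ¬ (k ≤ (r : ℕ) ∧ k ≤ (s : ℕ)) := fun h => hs h.2
    simp only [restrictedSkew, Matrix.of_apply, if_neg hn, Matrix.zero_apply, Matrix.add_apply,
      Matrix.smul_apply, smul_eq_mul] at h1 ⊢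
    linarith

theorem skew_dot_s12 {d : ℕ} {R : Matrix (Fin d) (Fin d) ℝ} (hR : R ∈ skewSub d) (h : Fin d → ℝ) :
    R.mulVec h ⬝ᵥ h = 0 := by
  have h1 : Rᵀ = -R := by
    ext r s
    have := hR r s
    simp only [Matrix.transpose_apply, Matrix.neg_apply]
    linarith
  have h2 : R.mulVec h ⬝ᵥ h = - (R.mulVec h ⬝ᵥ h) := by
    conv_lhs => rw [dotProduct_comm, Matrix.dotProduct_mulVec, ← Matrix.mulVec_transpose, h1,
      Matrix.neg_mulVec, neg_dotProduct]
  linarith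

theorem mem_incVerts_tail {V E : Type*} [DecidableEq V] (tail head : E → V) {F : Finset E} {e : E}
    (he : e ∈ F) : tail e ∈ incVerts tail head F :=
  Finset.mem_union_left _ (Finset.mem_image_of_mem _ he)

theorem mem_incVerts_head {V E : Type*} [DecidableEq V] (tail head : E → V) {F : Finset E} {e : E}
    (he : e ∈ F) : head e ∈ incVerts tail head F :=
  Finset.mem_union_right _ (Finset.mem_image_of_mem _ he)

theorem row_motLin {E : Type*} {d n : ℕ} {k : Fin n → ℕ} {tail head : E → Fin n} {F : Finset E}
    {x : RigDom d n} (hx : x ∈ trivSub d n k tail head F) {e : E} (he : e ∈ F)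
    (Λ : Matrix (Fin d) (Fin d) ℝ) (c : Fin d → ℤ) {qm qp : Fin d → ℝ}
    (hm : ∀ r : Fin d, k (tail e) ≤ (r : ℕ) → qm r = 0)
    (hp : ∀ r : Fin d, k (head e) ≤ (r : ℕ) → qp r = 0) :
    rowLin d n k (tail e) (head e) Λ c qm qp (motLin d n Λ x) = 0 := by
  obtain ⟨h1, h2, h3⟩ := hx
  have h2' := mem_rotSub.mp h2
  rw [rowLin_apply]
  simp only [motLin, LinearMap.coe_mk, AddHom.coe_mk]
  rw [rs_mulVec (h2' _ (mem_incVerts_head tail head he)) h3 hp,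
    rs_mulVec (h2' _ (mem_incVerts_tail tail head he)) h3 hm, h1 e he, add_sub_cancel_right,
    ← Matrix.mulVec_mulVec, ← Matrix.mulVec_add, ← Matrix.mulVec_sub]
  exact skew_dot_s12 h3 _

theorem cast_single {d : ℕ} (r : Fin d) (a : ℤ) :
    (fun s => ((Pi.single r a : Fin d → ℤ) s : ℝ)) = Pi.single r (a : ℝ) := by
  funext s
  by_cases h : s = r
  · subst h; simp
  · simp [h]

theorem motion_trivial {E : Type*} {d n : ℕ} {k : Fin n → ℕ} {tail head : E → Fin n}
    {F : Finset E} (hF : F.Nonempty) {p : Fin n → Fin d → ℝ}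
    {B : Fin n → Matrix (Fin d) (Fin d) ℝ} {L : Matrix (Fin d) (Fin d) ℝ}
    (hx : ∀ e ∈ F, ∀ (c : Fin d → ℤ) (qm qp : Fin d → ℝ),
      (∀ r : Fin d, k (tail e) ≤ (r : ℕ) → qm r = 0) →
      (∀ r : Fin d, k (head e) ≤ (r : ℕ) → qp r = 0) →
      rowLin d n k (tail e) (head e) 1 c qm qp (p, B, L) = 0) :
    ((p, fun v => B v - (1 / 2 : ℝ) • L, L) : RigDom d n) ∈ trivSub d n k tail head F := by
  have key : ∀ e ∈ F, p (head e) = p (tail e) ∧ (∀ r, L r r = 0) ∧ L ∈ skewSub d := by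
    intro e he
    have h0 : ∀ c : Fin d → ℤ, (L.mulVec (fun r => (c r : ℝ)) + p (head e) - p (tail e))
        ⬝ᵥ (fun r => (c r : ℝ)) = 0 := by
      intro c
      have := hx e he c 0 0 (fun _ _ => rfl) (fun _ _ => rfl)
      rw [rowLin_apply] at this
      simpa only [Matrix.mulVec_zero, add_zero, sub_zero, Matrix.one_mulVec] using this
    have ha : ∀ r, L r r + p (head e) r - p (tail e) r = 0 := by
      intro r
      have := h0 (Pi.single r 1)
      rw [cast_single] at this
      simpa using this
    have hb : ∀ r, -L r r + p (head e) r - p (tail e) r = 0 := by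
      intro r
      have := h0 (Pi.single r (-1))
      rw [cast_single] at this
      simp [Matrix.mulVec_single] at this
      linarith
    have hd : ∀ r, L r r = 0 := fun r => by linarith [ha r, hb r]
    have hp : p (head e) = p (tail e) := by
      funext r
      linarith [ha r, hb r]
    refine ⟨hp, hd, ?_⟩
    intro r s
    have := h0 (Pi.single r 1 + Pi.single s 1)
    have hc : (fun t => ((Pi.single r 1 + Pi.single s 1 : Fin d → ℤ) t : ℝ))
        = Pi.single r 1 + Pi.single s 1 := by
      have h1 := cast_single r 1
      have h2 := cast_single s 1
      simp only [Int.cast_one] at h1 h2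
      rw [← h1, ← h2]
      funext t
      simp only [Pi.add_apply, Int.cast_add]
    rw [hc, hp, add_sub_cancel_right, Matrix.mulVec_add, add_dotProduct, dotProduct_add,
      dotProduct_add] at this
    simp [hd] at this
    linarith
  obtain ⟨e0, he0⟩ := hF
  obtain ⟨-, hd, hL⟩ := key e0 he0
  have hcol : ∀ v ∈ incVerts tail head F, ∀ r s : Fin d, (s : ℕ) < k v →
      restrictedSkew d (k v) (B v) r s = L r s := by
    intro v hv r s hs
    have hdiag : restrictedSkew d (k v) (B v) s s = 0 := by simp [restrictedSkew]
    have hcs : (fun t => ((Pi.single r 1 : Fin d → ℤ) t : ℝ)) = Pi.single r 1 := by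
      have h1 := cast_single r 1
      simpa only [Int.cast_one] using h1
    have hfin : (L.mulVec (Pi.single r 1) + (restrictedSkew d (k v) (B v)).mulVec (Pi.single s 1))
        ⬝ᵥ (Pi.single r 1 + Pi.single s 1) = 0 := by
      rcases Finset.mem_union.mp hv with h | h
      · obtain ⟨e, he, rfl⟩ := Finset.mem_image.mp h
        have := hx e he (Pi.single r 1) (-Pi.single s 1) 0 (by
          intro t ht
          have : t ≠ s := by rintro rfl; omega
          simp [this]) (fun _ _ => rfl)
        rw [rowLin_apply, hcs] at this
        simp only [(key e he).1, Matrix.mulVec_zero, add_zero, Matrix.one_mulVec,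
          add_sub_cancel_right, Matrix.mulVec_neg, sub_neg_eq_add] at this
        exact this
      · obtain ⟨e, he, rfl⟩ := Finset.mem_image.mp h
        have := hx e he (Pi.single r 1) 0 (Pi.single s 1) (fun _ _ => rfl) (by
          intro t ht
          have : t ≠ s := by rintro rfl; omega
          simp [this])
        rw [rowLin_apply, hcs] at this
        simp only [(key e he).1, Matrix.mulVec_zero, sub_zero, Matrix.one_mulVec,
          add_sub_cancel_right] at this
        exact this
    rw [add_dotProduct, dotProduct_add, dotProduct_add] at hfin
    simp [hd, hdiag] at hfin
    have := hL r s
    linarith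
  refine ⟨fun e he => (key e he).1, mem_rotSub.mpr ?_, hL⟩
  intro v hv
  ext r s
  have hrs := hL r s
  by_cases hn : k v ≤ (r : ℕ) ∧ k v ≤ (s : ℕ)
  · simp only [restrictedSkew, Matrix.of_apply, if_pos hn, Matrix.zero_apply]
  · have hn' : ¬ (k v ≤ (s : ℕ) ∧ k v ≤ (r : ℕ)) := fun h => hn ⟨h.2, h.1⟩
    by_cases hs : (s : ℕ) < k v
    · have h1 := hcol v hv r s hs
      simp only [restrictedSkew, Matrix.of_apply, if_neg hn, Matrix.zero_apply, Matrix.sub_apply,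
        Matrix.smul_apply, smul_eq_mul] at h1 ⊢
      linarith
    · have h1 := hcol v hv s r (by omega)
      simp only [restrictedSkew, Matrix.of_apply, if_neg hn, if_neg hn', Matrix.zero_apply,
        Matrix.sub_apply, Matrix.smul_apply, smul_eq_mul] at h1 ⊢
      linarith

theorem span_range_linear {M N : Type*} [AddCommGroup M] [Module ℝ M] [AddCommGroup N] [Module ℝ N]
    (G : M →ₗ[ℝ] N) : Submodule.span ℝ (Set.range fun x => G x) = LinearMap.range G := by
  have : (Set.range fun x => G x) = (LinearMap.range G : Set N) := rfl
  rw [this, Submodule.span_eq]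

theorem pi_surjective {M E : Type*} [AddCommGroup M] [Module ℝ M] [Fintype E] [DecidableEq E]
    {φ : E → Module.Dual ℝ M} (h : LinearIndependent ℝ φ) :
    Function.Surjective (LinearMap.pi φ) := by
  by_contra hs
  rw [← LinearMap.range_eq_top] at hs
  obtain ⟨f, hf, hle⟩ := Submodule.exists_le_ker_of_lt_top _ (lt_top_iff_ne_top.mpr hs)
  rw [Fintype.linearIndependent_iff] at h
  apply hf
  have h0 : ∀ y : E → ℝ, f y = ∑ e, f (Pi.single e 1) * y e := by
    intro y
    conv_lhs => rw [pi_eq_sum_univ' y, map_sum]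
    refine Finset.sum_congr rfl fun e _ => ?_
    rw [map_smul, smul_eq_mul, mul_comm]
  have h1 := h (fun e => f (Pi.single e 1)) (by
    ext x
    have := hle ⟨x, rfl⟩
    rw [LinearMap.mem_ker, h0] at this
    simpa [LinearMap.sum_apply] using this)
  ext e
  simpa using h1 e

theorem finrank_map_inj {M N : Type*} [AddCommGroup M] [Module ℝ M] [AddCommGroup N] [Module ℝ N]
    {G : M →ₗ[ℝ] N} (hG : Function.Injective G) (S : Submodule ℝ M) :
    Module.finrank ℝ (S.map G) = Module.finrank ℝ S :=
  (Submodule.equivMapOfInjective G hG S).finrank_eq.symm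

theorem necessity {E : Type*} [Fintype E] [DecidableEq E] {d n : ℕ} (tail head : E → Fin n)
    (k : Fin n → ℕ) (Λ : Matrix (Fin d) (Fin d) ℝ) (c : E → Fin d → ℤ) (qm qp : E → Fin d → ℝ)
    (hΛ : IsUnit Λ) (hq : IsMixedAttachment d n k tail head qm qp)
    (hr : mixedRigidityRank d n k tail head Λ c qm qp Finset.univ = Fintype.card E)
    (F : Finset E) :
    F.card + Module.finrank ℝ (trivSub d n k tail head F) ≤ Module.finrank ℝ (RigDom d n) := by
  let φ : E → Module.Dual ℝ (RigDom d n) :=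
    fun e => rowLin d n k (tail e) (head e) Λ (c e) (qm e) (qp e)
  let G : RigDom d n →ₗ[ℝ] ({e : E // e ∈ (Finset.univ : Finset E)} → ℝ) := LinearMap.pi fun e => φ e.1
  have hG : mixedRigidityRank d n k tail head Λ c qm qp Finset.univ
      = Module.finrank ℝ (LinearMap.range G) := by
    rw [← span_range_linear G]; rfl
  have hGs : Function.Surjective G := by
    rw [← LinearMap.range_eq_top]
    apply Submodule.eq_top_of_finrank_eq
    rw [← hG, hr]
    simp
  let GF : RigDom d n →ₗ[ℝ] (F → ℝ) := LinearMap.pi fun e => φ e.1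
  have hGF : Function.Surjective GF := by
    intro y
    obtain ⟨x, hx⟩ := hGs (fun e => if h : e.1 ∈ F then y ⟨e.1, h⟩ else 0)
    refine ⟨x, ?_⟩
    funext e
    have := congrFun hx ⟨e.1, Finset.mem_univ _⟩
    simp only [e.2, dif_pos] at this
    exact this
  have hrn := LinearMap.finrank_range_add_finrank_ker GF
  rw [LinearMap.range_eq_top.mpr hGF, finrank_top, Module.finrank_fintype_fun_eq_card,
    Fintype.card_coe] at hrn
  have hle : (trivSub d n k tail head F).map (motLin d n Λ) ≤ LinearMap.ker GF := by
    rintro _ ⟨x, hx, rfl⟩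
    rw [LinearMap.mem_ker]
    funext e
    exact row_motLin hx e.2 Λ (c e.1) (fun r => (hq e.1 r).1) (fun r => (hq e.1 r).2)
  have h1 := Submodule.finrank_mono hle
  rw [finrank_map_inj (motLin_injective d n Λ hΛ)] at h1
  omega

/-- All admissible rows of an edge, for the standard lattice. -/
def rowSet (d n : ℕ) (k : Fin n → ℕ) (i j : Fin n) : Set (Module.Dual ℝ (RigDom d n)) :=
  {φ | ∃ (c : Fin d → ℤ) (qm qp : Fin d → ℝ),
    (∀ r : Fin d, k i ≤ (r : ℕ) → qm r = 0) ∧ (∀ r : Fin d, k j ≤ (r : ℕ) → qp r = 0) ∧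
    (1 : Matrix (Fin d) (Fin d) ℝ).mulVec (fun r => (c r : ℝ)) + qp - qm ≠ 0 ∧
    φ = rowLin d n k i j 1 c qm qp}

theorem rowSet_rank {E : Type*} {d n : ℕ} (tail head : E → Fin n) (k : Fin n → ℕ) {F : Finset E}
    (hF : F.Nonempty) :
    Module.finrank ℝ (RigDom d n) ≤ Module.finrank ℝ (trivSub d n k tail head F) +
      Module.finrank ℝ (⨆ e ∈ F, Submodule.span ℝ (rowSet d n k (tail e) (head e)) :
        Submodule ℝ (Module.Dual ℝ (RigDom d n))) := by
  set W := (⨆ e ∈ F, Submodule.span ℝ (rowSet d n k (tail e) (head e)) :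
        Submodule ℝ (Module.Dual ℝ (RigDom d n))) with hW
  have h1 := Subspace.finrank_add_finrank_dualCoannihilator_eq W
  have hle : W.dualCoannihilator ≤ (trivSub d n k tail head F).map (motLin d n 1) := by
    rintro ⟨p, B, L⟩ hx
    rw [Submodule.mem_dualCoannihilator] at hx
    refine ⟨_, motion_trivial (k := k) (tail := tail) (head := head) hF (p := p) (B := B) (L := L)
      ?_, ?_⟩
    · intro e he c qm qp hm hp
      by_cases hz : (1 : Matrix (Fin d) (Fin d) ℝ).mulVec (fun r => (c r : ℝ)) + qp - qm = 0
      · rw [rowLin_apply, hz, dotProduct_zero]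
      · refine hx _ ?_
        have h3 : Submodule.span ℝ (rowSet d n k (tail e) (head e)) ≤ W :=
          le_biSup (fun e => Submodule.span ℝ (rowSet d n k (tail e) (head e))) he
        exact h3 (Submodule.subset_span ⟨c, qm, qp, hm, hp, hz, rfl⟩)
    · simp [motLin]
  have h2 := Submodule.finrank_mono hle
  rw [finrank_map_inj (motLin_injective d n 1 isUnit_one)] at h2
  omega

/-- Maxwell–Laman characterization for mixed plate-and-bar periodic
frameworks, Theorem 4 of the paper.  With vertex weights `k_v ∈ {0,…,d}`,
`k_v' = d·k_v − C(k_v+1,2)` and `|E| = d(n−1) + Σ_v k_v' + C(d+1,2)`, some mixed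
presentation has mixed rigidity matrix of full rank `|E|` iff
`|F| ≤ d(n_F − ω_F) + Σ_{v∈V_F} k_v' + C(d+1,2)` for every nonempty `F ⊆ E`. -/
theorem stmt_12 {d n : ℕ} (hd : 1 ≤ d) {E : Type*} [Fintype E] [DecidableEq E]
    (tail head : E → Fin n) (k : Fin n → ℕ) (hk : ∀ v, k v ≤ d)
    (hE : Fintype.card E + d =
      d * n + (∑ v, (d * k v - (k v + 1).choose 2)) + (d + 1).choose 2) :
    (∃ (Λ : Matrix (Fin d) (Fin d) ℝ) (c : E → Fin d → ℤ) (qm qp : E → Fin d → ℝ),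
        IsUnit Λ ∧ (∀ e, edgeVec d Λ c qm qp e ≠ 0) ∧
        IsMixedAttachment d n k tail head qm qp ∧
        mixedRigidityRank d n k tail head Λ c qm qp Finset.univ = Fintype.card E)
      ↔ ∀ F : Finset E, F.Nonempty →
          (F.card : ℤ) ≤
            (d : ℤ) * ((incVerts tail head F).card - numComp tail head F)
              + (∑ v ∈ incVerts tail head F, ((d * k v - (k v + 1).choose 2 : ℕ) : ℤ))
              + ((d + 1).choose 2 : ℤ) := by
  constructor
  · rintro ⟨Λ, c, qm, qp, hΛ, -, hq, hr⟩ F -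
    have h1 := necessity tail head k Λ c qm qp hΛ hq hr F
    have h2 := finrank_trivSub d n k hk tail head F
    have h3 : F.card + d * numComp tail head F ≤ d * (incVerts tail head F).card +
      ∑ v ∈ incVerts tail head F, (d * k v - (k v + 1).choose 2) + (d + 1).choose 2 := by omega
    have h4 : (F.card : ℤ) + d * numComp tail head F ≤ d * (incVerts tail head F).card +
      ((∑ v ∈ incVerts tail head F, (d * k v - (k v + 1).choose 2) : ℕ) : ℤ)
        + (d + 1).choose 2 := by exact_mod_cast h3
    rw [Nat.cast_sum] at h4
    rw [mul_sub]
    linarith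
  · intro h
    obtain ⟨φ, hφ, hli⟩ := rado_set (K := ℝ) (fun e => rowSet d n k (tail e) (head e)) (by
      intro F
      rcases F.eq_empty_or_nonempty with rfl | hF
      · simp
      have h1 := rowSet_rank (d := d) tail head k hF
      have h2 := finrank_trivSub d n k hk tail head F
      have h4 := h F hF
      rw [← Nat.cast_sum, mul_sub] at h4
      have h5 : (F.card : ℤ) + d * numComp tail head F ≤ d * (incVerts tail head F).card +
        ((∑ v ∈ incVerts tail head F, (d * k v - (k v + 1).choose 2) : ℕ) : ℤ)
        + (d + 1).choose 2 := by linarith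
      have h3 : F.card + d * numComp tail head F ≤ d * (incVerts tail head F).card +
        ∑ v ∈ incVerts tail head F, (d * k v - (k v + 1).choose 2) + (d + 1).choose 2 := by
        exact_mod_cast h5
      omega)
    choose c qm qp hm hp hne hφ' using hφ
    refine ⟨1, c, qm, qp, isUnit_one, hne, fun e r => ⟨hm e r, hp e r⟩, ?_⟩
    have hs := pi_surjective hli
    let G : RigDom d n →ₗ[ℝ] ({e : E // e ∈ (Finset.univ : Finset E)} → ℝ) := LinearMap.pi fun e => φ e.1
    have hGs : Function.Surjective G := by
      intro y
      obtain ⟨x, hx⟩ := hs (fun e => y ⟨e, Finset.mem_univ _⟩)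
      exact ⟨x, funext fun e => congrFun hx e.1⟩
    have hG : mixedRigidityRank d n k tail head 1 c qm qp Finset.univ
        = Module.finrank ℝ (LinearMap.range G) := by
      rw [← span_range_linear G]
      have : (fun x : RigDom d n => fun e : (Finset.univ : Finset E) =>
          mixedRowVal d n k tail head 1 c qm qp x e.1) = fun x => G x := by
        funext x e
        change _ = φ e.1 x
        rw [hφ' e.1]
        rfl
      unfold mixedRigidityRank
      rw [this]
    rw [hG, LinearMap.range_eq_top.mpr hGs, finrank_top]
    simp
end

section
/- Let G be a multigraph on a finite vertex set V with edge set E, and let k : V → ℕ be such that |E| = Σ_{v∈V} k_v and |F| ≤ Σ_{v ∈ V_F} k_v for every nonempty subset F ⊆ E. Then there exists a map σ : E → V with σ(e) an endpoint of e for every edge e, such that |σ⁻¹(v)| = k_v for every vertex v. (Lemma: E is obtained by loop breaking from the multigraph with exactly k_v loops at each vertex v; equivalently, G admits an orientation in which every vertex v has in-degree exactly k_v.) -/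
/-- orientation lemma, after Hakimi.  If `|E| = Σ_v k_v` and
`|F| ≤ Σ_{v∈V_F} k_v` for every nonempty `F ⊆ E`, then each edge can be assigned to
one of its endpoints so that exactly `k_v` edges are assigned to each vertex `v`
(equivalently, `G` is obtained by loop breaking from the multigraph with `k_v` loops
at each vertex `v`). -/
theorem stmt_13 {V E : Type*} [Fintype V] [DecidableEq V] [Fintype E] [DecidableEq E]
    (tail head : E → V) (k : V → ℕ)
    (hcard : Fintype.card E = ∑ v, k v)
    (hsp : ∀ F : Finset E, F.Nonempty → F.card ≤ ∑ v ∈ incVerts tail head F, k v) :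
    ∃ σ : E → V, (∀ e, σ e = tail e ∨ σ e = head e) ∧
      ∀ v, (Finset.univ.filter fun e => σ e = v).card = k v := by
  classical
  let t : E → Finset (Σ v : V, Fin (k v)) := fun e =>
    ({tail e, head e} : Finset V).sigma fun _ => Finset.univ
  have hall : ∀ s : Finset E, s.card ≤ (s.biUnion t).card := by
    intro F
    rcases F.eq_empty_or_nonempty with rfl | hF
    · simp
    refine (hsp F hF).trans ?_
    have h : F.biUnion t = (incVerts tail head F).sigma fun _ => Finset.univ := by
      ext ⟨v, i⟩
      simp only [t, incVerts, Finset.mem_biUnion, Finset.mem_sigma, Finset.mem_insert,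
        Finset.mem_singleton, Finset.mem_univ, and_true, Finset.mem_union, Finset.mem_image]
      grind
    rw [h, Finset.card_sigma]
    simp
  obtain ⟨f, hinj, hf⟩ := (Finset.all_card_le_biUnion_card_iff_exists_injective t).1 hall
  have hbij : Function.Bijective f := by
    rw [Fintype.bijective_iff_injective_and_card]
    refine ⟨hinj, ?_⟩
    simp [hcard]
  refine ⟨fun e => (f e).1, fun e => ?_, fun v => ?_⟩
  · have := hf e
    simpa [t] using this
  · have h : ((Finset.univ.filter fun e => (f e).1 = v).image f) =
        ({v} : Finset V).sigma fun _ => Finset.univ := by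
      ext x
      obtain ⟨e, rfl⟩ := hbij.2 x
      simp [hinj.eq_iff]
    rw [← Finset.card_image_of_injective _ hinj, h, Finset.card_sigma]
    simp
end
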